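/- arXiv:1805.02471 — 2 statements merged into one kernel-verified Lean document; each statement's English description precedes it below -/
import Mathlib

section
/- If Z is an S₊-valued complete Bernstein function (CBF) on (0,∞) that does not vanish identically and Z(p) is invertible for every p > 0, then the function p ↦ Z(p)^{−1} is an S₊-valued Stieltjes function. -/
open MeasureTheory Set Filter Topology Matrix

noncomputable section

/-- A matrix-valued function `A` on `(0,∞)` is completely monotone (CM): each entry is
infinitely differentiable on `(0,∞)` and for every `v : ℝ^m` and `n : ℕ`,
`(-1)^n (d/dt)^n (vᵀ A(t) v) ≥ 0` for `t > 0`. -/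
def MatCM (m : ℕ) (A : ℝ → Matrix (Fin m) (Fin m) ℝ) : Prop :=
  (∀ i j, ContDiffOn ℝ (⊤ : ℕ∞) (fun t => A t i j) (Set.Ioi 0)) ∧
  ∀ v : Fin m → ℝ, ∀ n : ℕ, ∀ t ∈ Set.Ioi (0:ℝ),
    0 ≤ (-1 : ℝ) ^ n * iteratedDeriv n (fun s => v ⬝ᵥ (A s).mulVec v) t

/-- Locally integrable completely monotone (LICM): CM and integrable over `(0,1]`. -/
def MatLICM (m : ℕ) (A : ℝ → Matrix (Fin m) (Fin m) ℝ) : Prop :=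
  MatCM m A ∧ ∀ i j, MeasureTheory.IntegrableOn (fun t => A t i j) (Set.Ioc 0 1)

/-- Entrywise derivative of a matrix-valued function. -/
def matDeriv (m : ℕ) (A : ℝ → Matrix (Fin m) (Fin m) ℝ) : ℝ → Matrix (Fin m) (Fin m) ℝ :=
  fun t => Matrix.of fun i j => deriv (fun s => A s i j) t

/-- A matrix-valued Bernstein function: differentiable on `(0,∞)` with CM derivative. -/
def MatBernstein (m : ℕ) (A : ℝ → Matrix (Fin m) (Fin m) ℝ) : Prop :=
  (∀ i j, DifferentiableOn ℝ (fun t => A t i j) (Set.Ioi 0)) ∧ MatCM m (matDeriv m A)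

/-- The Laplace transform `Ã(p) = ∫₀^∞ e^{-pt} A(t) dt` (entrywise). -/
def matLaplace (m : ℕ) (A : ℝ → Matrix (Fin m) (Fin m) ℝ) (p : ℝ) :
    Matrix (Fin m) (Fin m) ℝ :=
  Matrix.of fun i j => ∫ t in Set.Ioi (0:ℝ), Real.exp (-p * t) * A t i j

/-- Convolution of matrix-valued functions: `(A∗B)(t) = ∫₀ᵗ A(s) B(t-s) ds`. -/
def matConv (m : ℕ) (A B : ℝ → Matrix (Fin m) (Fin m) ℝ) (t : ℝ) :
    Matrix (Fin m) (Fin m) ℝ :=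
  Matrix.of fun i j => ∫ s in (0:ℝ)..t, ∑ k, A s i k * B (t - s) k j

/-- Convolution of a matrix-valued function with a vector-valued function:
`(A∗v)(t) = ∫₀ᵗ A(s) v(t-s) ds`. -/
def matVecConv (m : ℕ) (A : ℝ → Matrix (Fin m) (Fin m) ℝ) (v : ℝ → Fin m → ℝ) (t : ℝ) :
    Fin m → ℝ :=
  fun i => ∫ s in (0:ℝ)..t, ∑ k, A s i k * v (t - s) k

/-- An `S₊`-valued Stieltjes function: `Y(p) = C + ∫_{[0,∞)} (p + r)⁻¹ G(r) μ(dr)` with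
`C ∈ S₊`, `μ` a Borel measure on `[0,∞)` with `∫ (1+r)⁻¹ μ(dr) < ∞`, and `G` a measurable
`S₊`-valued function bounded `μ`-almost everywhere. -/
def IsStieltjesM (m : ℕ) (Y : ℝ → Matrix (Fin m) (Fin m) ℝ) : Prop :=
  ∃ (C : Matrix (Fin m) (Fin m) ℝ) (μ : MeasureTheory.Measure ℝ)
    (G : ℝ → Matrix (Fin m) (Fin m) ℝ),
    C.PosSemidef ∧ μ (Set.Iio 0) = 0 ∧
    (∫⁻ r in Set.Ici (0:ℝ), ENNReal.ofReal ((1 + r)⁻¹) ∂μ) < ⊤ ∧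
    (∀ i j, Measurable fun r => G r i j) ∧
    (∀ᵐ r ∂μ, (G r).PosSemidef) ∧
    (∃ M : ℝ, ∀ᵐ r ∂μ, ∀ i j, |G r i j| ≤ M) ∧
    ∀ p ∈ Set.Ioi (0:ℝ),
      Y p = C + Matrix.of fun i j => ∫ r in Set.Ici (0:ℝ), (p + r)⁻¹ * G r i j ∂μ

/-- An `S₊`-valued complete Bernstein function (CBF):
`Z(p) = p·B + p·∫_{[0,∞)} (p + r)⁻¹ H(r) ν(dr)` with `B ∈ S₊`, `ν` a Borel measure on
`[0,∞)` with `∫ (1+r)⁻¹ ν(dr) < ∞`, and `H` a measurable `S₊`-valued function bounded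
`ν`-almost everywhere. -/
def IsCBFM (m : ℕ) (Z : ℝ → Matrix (Fin m) (Fin m) ℝ) : Prop :=
  ∃ (B : Matrix (Fin m) (Fin m) ℝ) (ν : MeasureTheory.Measure ℝ)
    (H : ℝ → Matrix (Fin m) (Fin m) ℝ),
    B.PosSemidef ∧ ν (Set.Iio 0) = 0 ∧
    (∫⁻ r in Set.Ici (0:ℝ), ENNReal.ofReal ((1 + r)⁻¹) ∂ν) < ⊤ ∧
    (∀ i j, Measurable fun r => H r i j) ∧
    (∀ᵐ r ∂ν, (H r).PosSemidef) ∧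
    (∃ M : ℝ, ∀ᵐ r ∂ν, ∀ i j, |H r i j| ≤ M) ∧
    ∀ p ∈ Set.Ioi (0:ℝ),
      Z p = p • B + Matrix.of fun i j => ∫ r in Set.Ici (0:ℝ), p * (p + r)⁻¹ * H r i j ∂ν

theorem add_smul_mul_inv_mul_sub_eq_one {m ι : Type*} [Fintype m] [DecidableEq m] [Fintype ι]
    [DecidableEq ι] {A : Matrix m m ℝ} {D E : Matrix ι ι ℝ} (W : Matrix ι m ℝ) (q : ℝ)
    (hA : IsUnit A) (hD : IsUnit D) (hE : IsUnit E) (h : E = D + q • (W * A⁻¹ * Wᵀ)) :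
    (A + q • (Wᵀ * D⁻¹ * W)) * (A⁻¹ - q • (A⁻¹ * Wᵀ * E⁻¹ * W * A⁻¹)) = 1 := by
  rw [isUnit_iff_isUnit_det] at hA hD hE
  have h1 : q • (D⁻¹ * (W * A⁻¹ * Wᵀ) * E⁻¹) = D⁻¹ - E⁻¹ := by
    have : q • (W * A⁻¹ * Wᵀ) = E - D := by rw [h]; abel
    rw [← Matrix.smul_mul, ← Matrix.mul_smul, this, Matrix.mul_sub, Matrix.sub_mul,
      Matrix.mul_assoc, mul_nonsing_inv _ hE, nonsing_inv_mul _ hD]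
    simp
  have h2 : q • (q • (Wᵀ * D⁻¹ * W * (A⁻¹ * Wᵀ * E⁻¹ * W * A⁻¹)))
      = q • (Wᵀ * (D⁻¹ - E⁻¹) * W * A⁻¹) := by
    rw [← h1]
    simp only [Matrix.mul_smul, Matrix.smul_mul, Matrix.mul_assoc]
  rw [Matrix.add_mul, Matrix.mul_sub, Matrix.mul_sub, mul_nonsing_inv _ hA, Matrix.mul_smul,
    Matrix.smul_mul, Matrix.smul_mul, Matrix.mul_smul, h2]
  have h3 : A * (A⁻¹ * Wᵀ * E⁻¹ * W * A⁻¹) = Wᵀ * E⁻¹ * W * A⁻¹ := by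
    simp only [← Matrix.mul_assoc, mul_nonsing_inv _ hA, Matrix.one_mul]
  rw [h3, Matrix.mul_sub, Matrix.sub_mul, Matrix.sub_mul, smul_sub]
  abel

theorem one_add_mul_pos {q s : ℝ} (hq : -1 < q) (h0 : 0 ≤ s) (h1 : s ≤ 1) : 0 < 1 + q * s := by
  rcases h0.eq_or_lt with rfl | h
  · simp
  · nlinarith [mul_pos (neg_lt_iff_pos_add'.1 hq) h]

theorem inv_transpose_mul_diagonal_mul {m ι : Type*} [Fintype m] [DecidableEq m] [Fintype ι]
    [DecidableEq ι] (s : ι → ℝ) (hs : ∀ i, 0 < s i ∧ s i ≤ 1) (V : Matrix ι m ℝ)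
    (hV : IsUnit (Vᵀ * V)) :
    ∃ (l : ι → ℝ) (L₀ : Matrix m m ℝ) (X : Matrix m ι ℝ), (∀ k, 0 < l k ∧ l k ≤ 1) ∧
      L₀.PosSemidef ∧ ∀ p : ℝ, 0 < p →
        (p • (Vᵀ * diagonal (fun i => (1 + (p - 1) * s i)⁻¹) * V))⁻¹
          = L₀ + X * diagonal (fun k => (1 + (p - 1) * l k)⁻¹) * Xᵀ := by
  set A := Vᵀ * V with hAdef
  have hA0 : A.PosSemidef := by
    simpa [conjTranspose_eq_transpose_of_trivial] using posSemidef_conjTranspose_mul_self V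
  have hAi : A⁻¹.PosSemidef := hA0.inv
  have hAT : A⁻¹ᵀ = A⁻¹ := by
    simpa [conjTranspose_eq_transpose_of_trivial] using hAi.isHermitian.eq
  have hAd := (isUnit_iff_isUnit_det _).1 hV
  set R : Matrix ι ι ℝ := diagonal (fun i => √(1 - s i)) with hR
  have hRT : Rᵀ = R := by simp [hR]
  have hRR : R * R = 1 - diagonal s := by
    rw [hR, diagonal_mul_diagonal, ← diagonal_one, diagonal_sub]
    congr 1; ext i; rw [Real.mul_self_sqrt (by linarith [hs i])]
  set W := R * V with hW
  set T := diagonal s + W * A⁻¹ * Wᵀ with hT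
  have hSpd : (diagonal s).PosDef := PosDef.diagonal (fun i => (hs i).1)
  have hTpd : T.PosDef := hSpd.add_posSemidef
    (by simpa [conjTranspose_eq_transpose_of_trivial] using hAi.mul_mul_conjTranspose_same W)
  set P := V * A⁻¹ * Vᵀ with hP
  have hPT : Pᵀ = P := by simp [hP, hAT, Matrix.mul_assoc]
  have hPP : P * P = P := by
    calc P * P = V * (A⁻¹ * (Vᵀ * V)) * A⁻¹ * Vᵀ := by simp only [hP, Matrix.mul_assoc]
      _ = P := by rw [← hAdef, nonsing_inv_mul _ hAd, Matrix.mul_one]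
  have hP1 : (1 - P).PosSemidef := by
    have := posSemidef_conjTranspose_mul_self (1 - P)
    simpa [conjTranspose_eq_transpose_of_trivial, hPT, Matrix.mul_sub, Matrix.sub_mul, hPP]
      using this
  have hT1 : (1 - T).PosSemidef := by
    have := hP1.conjTranspose_mul_mul_same R
    rw [conjTranspose_eq_transpose_of_trivial, hRT, Matrix.mul_sub, Matrix.sub_mul, Matrix.mul_one,
      hRR] at this
    convert this using 1
    rw [hT, hW, hP, transpose_mul, hRT]
    simp only [Matrix.mul_assoc]
    abel
  set l := hTpd.isHermitian.eigenvalues with hl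
  set U : Matrix ι ι ℝ := (hTpd.isHermitian.eigenvectorUnitary : Matrix ι ι ℝ) with hU
  have hUU : U * Uᵀ = 1 := by
    have := (Unitary.mem_iff.1 hTpd.isHermitian.eigenvectorUnitary.2).2
    simpa [star_eq_conjTranspose, conjTranspose_eq_transpose_of_trivial] using this
  have hUU' : Uᵀ * U = 1 := by
    have := (Unitary.mem_iff.1 hTpd.isHermitian.eigenvectorUnitary.2).1
    simpa [star_eq_conjTranspose, conjTranspose_eq_transpose_of_trivial] using this
  have hspec : T = U * diagonal l * Uᵀ := by
    have := hTpd.isHermitian.spectral_theorem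
    simpa [Unitary.conjStarAlgAut_apply, star_eq_conjTranspose,
      conjTranspose_eq_transpose_of_trivial, Function.comp_def] using this
  have hl0 : ∀ k, 0 < l k := hTpd.eigenvalues_pos
  have hl1 : ∀ k, l k ≤ 1 := by
    intro k
    have := hT1.conjTranspose_mul_mul_same U
    have h2 : Uᵀ * (1 - T) * U = diagonal (fun k => 1 - l k) := by
      rw [Matrix.mul_sub, Matrix.sub_mul, Matrix.mul_one, hUU', hspec]
      have : Uᵀ * (U * diagonal l * Uᵀ) * U = (Uᵀ * U) * diagonal l * (Uᵀ * U) := by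
        simp only [Matrix.mul_assoc]
      rw [this, hUU', Matrix.one_mul, Matrix.mul_one, ← diagonal_one, diagonal_sub]
    rw [conjTranspose_eq_transpose_of_trivial, h2] at this
    have := this.diag_nonneg (i := k)
    simp at this
    exact this
  have hinvconj : ∀ d : ι → ℝ, (∀ k, d k ≠ 0) →
      (U * diagonal d * Uᵀ)⁻¹ = U * diagonal (fun k => (d k)⁻¹) * Uᵀ := by
    intro d hd
    apply inv_eq_right_inv
    calc U * diagonal d * Uᵀ * (U * diagonal (fun k => (d k)⁻¹) * Uᵀ)
        = U * diagonal d * (Uᵀ * U) * diagonal (fun k => (d k)⁻¹) * Uᵀ := by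
          simp only [Matrix.mul_assoc]
      _ = 1 := by
        rw [hUU', Matrix.mul_one, Matrix.mul_assoc U, diagonal_mul_diagonal]
        simp [hd, hUU]
  set X₀ := A⁻¹ * Wᵀ * U with hX₀
  have hX₀T : X₀ᵀ = Uᵀ * W * A⁻¹ := by simp [hX₀, hAT, Matrix.mul_assoc]
  have hAXA : ∀ M : Matrix ι ι ℝ, A⁻¹ * Wᵀ * (U * M * Uᵀ) * W * A⁻¹ = X₀ * M * X₀ᵀ := by
    intro M; rw [hX₀T, hX₀]; simp only [Matrix.mul_assoc]
  refine ⟨l, A⁻¹ - X₀ * diagonal (fun k => (l k)⁻¹) * X₀ᵀ,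
    X₀ * diagonal (fun k => √((l k)⁻¹)), fun k => ⟨hl0 k, hl1 k⟩, ?_, ?_⟩
  · have key := add_smul_mul_inv_mul_sub_eq_one W 1 hV hSpd.isUnit hTpd.isUnit (by simp [hT])
    have h3 := (inv_eq_right_inv key).symm
    rw [hspec, hinvconj l (fun k => (hl0 k).ne'), hAXA, one_smul, one_smul] at h3
    rw [h3]
    exact (hA0.add (by simpa [conjTranspose_eq_transpose_of_trivial] using
      hSpd.posSemidef.inv.conjTranspose_mul_mul_same W)).inv
  · intro p hp
    have hpos : ∀ x : ℝ, 0 < x → x ≤ 1 → 0 < 1 + (p - 1) * x := fun x h0 h1 =>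
      one_add_mul_pos (by linarith) h0.le h1
    have hDpd : (diagonal (fun i => 1 + (p - 1) * s i)).PosDef :=
      PosDef.diagonal (fun i => hpos _ (hs i).1 (hs i).2)
    have hE : U * diagonal (fun k => 1 + (p - 1) * l k) * Uᵀ = 1 + (p - 1) • T := by
      have : diagonal (fun k => 1 + (p - 1) * l k) = 1 + (p - 1) • diagonal l := by
        ext i j; by_cases h : i = j <;> simp [h]
      rw [this, Matrix.mul_add, Matrix.add_mul, Matrix.mul_one, hUU, Matrix.mul_smul,
        Matrix.smul_mul, ← hspec]
    have hDi : (diagonal (fun i => 1 + (p - 1) * s i))⁻¹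
        = diagonal (fun i => (1 + (p - 1) * s i)⁻¹) := by
      apply inv_eq_right_inv
      rw [diagonal_mul_diagonal, ← diagonal_one]
      congr 1; ext i; exact mul_inv_cancel₀ (hpos _ (hs i).1 (hs i).2).ne'
    have hEu : IsUnit (U * diagonal (fun k => 1 + (p - 1) * l k) * Uᵀ) := by
      have h1 : IsUnit (diagonal (fun k => 1 + (p - 1) * l k)) :=
        (PosDef.diagonal (fun k => hpos _ (hl0 k) (hl1 k))).isUnit
      exact ((IsUnit.of_mul_eq_one _ hUU).mul h1).mul (IsUnit.of_mul_eq_one _ hUU')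
    have key := add_smul_mul_inv_mul_sub_eq_one W (p - 1) hV hDpd.isUnit hEu (by
      rw [hE, hT, smul_add, ← add_assoc]
      congr 1
      ext i j; by_cases h : i = j <;> simp [h])
    rw [hinvconj _ (fun k => (hpos _ (hl0 k) (hl1 k)).ne'), hAXA, hDi] at key
    have hZ : p • (Vᵀ * diagonal (fun i => (1 + (p - 1) * s i)⁻¹) * V)
        = A + (p - 1) • (Wᵀ * diagonal (fun i => (1 + (p - 1) * s i)⁻¹) * W) := by
      have h4 : p • diagonal (fun i => (1 + (p - 1) * s i)⁻¹)
          = 1 + (p - 1) • (R * diagonal (fun i => (1 + (p - 1) * s i)⁻¹) * R) := by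
        rw [hR, diagonal_mul_diagonal, diagonal_mul_diagonal, ← diagonal_one, ← diagonal_smul,
          ← diagonal_smul, diagonal_add]
        congr 1; ext i
        have := (hpos _ (hs i).1 (hs i).2).ne'
        have h5 : √(1 - s i) * (1 + (p - 1) * s i)⁻¹ * √(1 - s i)
            = (1 - s i) * (1 + (p - 1) * s i)⁻¹ := by
          rw [mul_right_comm, Real.mul_self_sqrt (by linarith [hs i])]
        simp only [Pi.smul_apply, smul_eq_mul, h5]
        field_simp
        ring
      rw [← Matrix.smul_mul, ← Matrix.mul_smul, h4, hW, transpose_mul, hRT, Matrix.mul_add,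
        Matrix.add_mul, Matrix.mul_one, ← hAdef, Matrix.mul_smul, Matrix.smul_mul]
      simp only [Matrix.mul_assoc]
    rw [hZ, inv_eq_right_inv key]
    have h6 : X₀ * diagonal (fun k => √((l k)⁻¹)) * diagonal (fun k => (1 + (p - 1) * l k)⁻¹)
          * (X₀ * diagonal (fun k => √((l k)⁻¹)))ᵀ
        = X₀ * diagonal (fun k => (l k)⁻¹ * (1 + (p - 1) * l k)⁻¹) * X₀ᵀ := by
      rw [transpose_mul, diagonal_transpose, Matrix.mul_assoc X₀, diagonal_mul_diagonal,
        ← Matrix.mul_assoc, Matrix.mul_assoc X₀, diagonal_mul_diagonal]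
      congr 3; ext k
      rw [mul_right_comm, Real.mul_self_sqrt (inv_nonneg.2 (hl0 k).le)]
    rw [h6, sub_add, ← Matrix.sub_mul, ← Matrix.mul_sub, diagonal_sub, ← Matrix.smul_mul,
      ← Matrix.mul_smul, ← diagonal_smul]
    congr 4
    ext k
    have := (hpos _ (hl0 k) (hl1 k)).ne'
    have := (hl0 k).ne'
    simp only [Pi.smul_apply, smul_eq_mul]
    field_simp
    ring

theorem Matrix.PosSemidef.abs_apply_le_trace {n : Type*} [Fintype n] [DecidableEq n]
    {M : Matrix n n ℝ} (hM : M.PosSemidef) (i j : n) : |M i j| ≤ M.trace := by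
  have hd : ∀ k, M k k ≤ M.trace := fun k =>
    Finset.single_le_sum (f := fun k => M k k) (fun k _ => hM.diag_nonneg) (Finset.mem_univ k)
  have hs : M j i = M i j := by simpa using hM.isHermitian.apply i j
  have h1 := hM.dotProduct_mulVec_nonneg (Pi.single i 1 + Pi.single j 1)
  have h2 := hM.dotProduct_mulVec_nonneg (Pi.single i 1 - Pi.single j 1)
  simp [mulVec_add, mulVec_sub, add_dotProduct, sub_dotProduct, hs] at h1 h2
  rw [abs_le]
  constructor <;> linarith [hd i, hd j]

theorem Matrix.isClosed_setOf_posSemidef (n : Type*) [Fintype n] :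
    IsClosed {M : Matrix n n ℝ | M.PosSemidef} := by
  simp only [posSemidef_iff_dotProduct_mulVec, ofPred_and, ofPred_forall]
  refine IsClosed.inter (isClosed_eq (by fun_prop) (by fun_prop)) (isClosed_iInter fun x => ?_)
  exact isClosed_le continuous_const (by fun_prop)

/-- Pairs `(s, K)` with `s ∈ [0,1]` and `K` a positive semidefinite matrix of trace one. -/
def poleResidueSet (m : ℕ) : Set (ℝ × (Fin m → Fin m → ℝ)) :=
  {x | x.1 ∈ Icc (0:ℝ) 1 ∧ (Matrix.of x.2).PosSemidef ∧ (Matrix.of x.2).trace = 1}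

theorem abs_snd_le_one_of_mem_poleResidueSet {m : ℕ} {x : ℝ × (Fin m → Fin m → ℝ)}
    (hx : x ∈ poleResidueSet m) (i j : Fin m) : |x.2 i j| ≤ 1 :=
  (hx.2.1.abs_apply_le_trace i j).trans_eq hx.2.2

theorem isClosed_poleResidueSet (m : ℕ) : IsClosed (poleResidueSet m) := by
  refine IsClosed.inter (isClosed_Icc.preimage continuous_fst) (IsClosed.inter ?_ ?_)
  · exact (Matrix.isClosed_setOf_posSemidef (Fin m)).preimage
      (f := fun x : ℝ × (Fin m → Fin m → ℝ) => Matrix.of x.2) continuous_snd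
  · refine isClosed_eq ?_ continuous_const
    simp only [Matrix.trace, Matrix.diag, Matrix.of_apply]
    fun_prop

theorem isCompact_poleResidueSet (m : ℕ) : IsCompact (poleResidueSet m) := by
  refine ((isCompact_Icc (a := (0:ℝ)) (b := 1)).prod (isCompact_univ_pi fun _ : Fin m =>
    isCompact_univ_pi fun _ : Fin m => isCompact_Icc (a := (-1:ℝ)) (b := 1))).of_isClosed_subset
    (isClosed_poleResidueSet m) ?_
  intro x hx
  exact ⟨hx.1, fun i _ j _ => abs_le.1 (abs_snd_le_one_of_mem_poleResidueSet hx i j)⟩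

instance (m : ℕ) : CompactSpace (poleResidueSet m) :=
  isCompact_iff_compactSpace.1 (isCompact_poleResidueSet m)

/-- `Y` is `t` times the transform of a probability measure on pole-residue pairs. -/
def HasPoleMeasure (m : ℕ) (t : ℝ) (Y : ℝ → Matrix (Fin m) (Fin m) ℝ) : Prop :=
  ∃ P : ProbabilityMeasure (poleResidueSet m), ∀ p : ℝ, 0 < p → ∀ i j,
    Y p i j = t * ∫ x, (1 + (p - 1) * x.1.1)⁻¹ * x.1.2 i j ∂(P : Measure (poleResidueSet m))

theorem HasPoleMeasure.of_tendsto {m : ℕ} {t : ℝ} {Y : ℝ → Matrix (Fin m) (Fin m) ℝ}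
    {Ys : ℕ → ℝ → Matrix (Fin m) (Fin m) ℝ} (hYs : ∀ n, HasPoleMeasure m t (Ys n))
    (hlim : ∀ p : ℝ, 0 < p → Tendsto (fun n => Ys n p) atTop (𝓝 (Y p))) :
    HasPoleMeasure m t Y := by
  choose P hP using hYs
  set U : Ultrafilter (ProbabilityMeasure (poleResidueSet m)) :=
    (hyperfilter ℕ).map P
  obtain ⟨Q, -, hQ⟩ := isCompact_univ.ultrafilter_le_nhds U (by simp)
  have hPQ : Tendsto P (hyperfilter ℕ) (𝓝 Q) := hQ
  rw [ProbabilityMeasure.tendsto_iff_forall_integral_tendsto] at hPQ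
  refine ⟨Q, fun p hp i j => ?_⟩
  have hcont : Continuous fun x : poleResidueSet m => (1 + (p - 1) * x.1.1)⁻¹ * x.1.2 i j := by
    refine Continuous.mul (Continuous.inv₀ (by fun_prop) fun x => ?_) (by fun_prop)
    exact (one_add_mul_pos (by linarith) x.2.1.1 x.2.1.2).ne'
  have h1 := (hPQ (BoundedContinuousFunction.mkOfCompact ⟨_, hcont⟩)).const_mul t
  have h2 : Tendsto (fun n => Ys n p i j) atTop (𝓝 (Y p i j)) :=
    ((continuous_apply_apply i j).tendsto _).comp (hlim p hp)
  refine tendsto_nhds_unique (h2.mono_left Nat.hyperfilter_le_atTop) (h1.congr fun n => ?_)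
  simp [hP n p hp i j]

theorem exists_trace_eq_one_eq_smul {m : ℕ} (hm : 0 < m) {L : Matrix (Fin m) (Fin m) ℝ}
    (hL : L.PosSemidef) : ∃ K : Matrix (Fin m) (Fin m) ℝ, K.PosSemidef ∧ K.trace = 1 ∧
      L = L.trace • K := by
  have hm' : (m : ℝ) ≠ 0 := by positivity
  rcases eq_or_ne L.trace 0 with h | h
  · refine ⟨(m : ℝ)⁻¹ • 1, PosSemidef.one.smul (by positivity), by simp [trace_smul, hm'], ?_⟩
    rw [h, zero_smul, ← hL.trace_eq_zero_iff, h]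
  · refine ⟨L.trace⁻¹ • L, hL.smul (inv_nonneg.2 hL.trace_nonneg), by simp [trace_smul, h], ?_⟩
    rw [smul_smul, mul_inv_cancel₀ h, one_smul]

theorem hasPoleMeasure_sum {m : ℕ} (hm : 0 < m) {t : ℝ} (ht : 0 < t) {κ : Type*} [Fintype κ]
    (l : κ → ℝ) (hl : ∀ k, l k ∈ Icc (0:ℝ) 1) (L : κ → Matrix (Fin m) (Fin m) ℝ)
    (hL : ∀ k, (L k).PosSemidef) (hsum : ∑ k, (L k).trace = t) :
    HasPoleMeasure m t (fun p => ∑ k, (1 + (p - 1) * l k)⁻¹ • L k) := by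
  choose K hK0 hK1 hK2 using fun k => exists_trace_eq_one_eq_smul hm (hL k)
  set x : κ → poleResidueSet m := fun k => ⟨(l k, K k), hl k, hK0 k, hK1 k⟩ with hx
  have hw : ∀ k, 0 ≤ (L k).trace / t := fun k => div_nonneg (hL k).trace_nonneg ht.le
  set μ : Measure (poleResidueSet m) :=
    ∑ k, ENNReal.ofReal ((L k).trace / t) • Measure.dirac (x k) with hμ
  have hprob : IsProbabilityMeasure μ := by
    constructor
    simp only [hμ, Measure.finsetSum_apply, Measure.smul_apply, measure_univ, smul_eq_mul, mul_one]
    rw [← ENNReal.ofReal_sum_of_nonneg fun k _ => hw k, ← Finset.sum_div, hsum, div_self ht.ne',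
      ENNReal.ofReal_one]
  refine ⟨⟨μ, hprob⟩, fun p hp i j => ?_⟩
  change _ = t * ∫ x, _ ∂μ
  rw [hμ, integral_finsetSum_measure
    fun k _ => (integrable_dirac (by simp [ENNReal.mul_lt_top])).smul_measure ENNReal.ofReal_ne_top]
  simp only [integral_smul_measure, integral_dirac, ENNReal.toReal_ofReal (hw _), Matrix.sum_apply,
    Matrix.smul_apply, smul_eq_mul, Finset.mul_sum]
  refine Finset.sum_congr rfl fun k _ => ?_
  conv_lhs => rw [hK2 k]
  simp only [hx, Matrix.smul_apply, smul_eq_mul]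
  field_simp

theorem Matrix.posSemidef_of_integral {α n : Type*} [Fintype n] [MeasurableSpace α]
    {μ : Measure α} {F : α → Matrix n n ℝ} (hint : ∀ i j, Integrable (fun a => F a i j) μ)
    (hF : ∀ᵐ a ∂μ, (F a).PosSemidef) :
    (Matrix.of fun i j => ∫ a, F a i j ∂μ).PosSemidef := by
  refine PosSemidef.of_dotProduct_mulVec_nonneg ?_ fun x => ?_
  · ext i j
    simp only [conjTranspose_apply, of_apply, star_trivial]
    refine integral_congr_ae (hF.mono fun a ha => ?_)
    simpa using ha.isHermitian.apply i j
  · have : star x ⬝ᵥ (Matrix.of fun i j => ∫ a, F a i j ∂μ) *ᵥ x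
        = ∫ a, star x ⬝ᵥ F a *ᵥ x ∂μ := by
      simp only [dotProduct, mulVec, of_apply, Finset.mul_sum]
      rw [integral_finsetSum _ fun i _ => integrable_finsetSum _ fun j _ =>
        ((hint i j).mul_const _).const_mul _]
      refine Finset.sum_congr rfl fun i _ => ?_
      rw [integral_finsetSum _ fun j _ => ((hint i j).mul_const _).const_mul _]
      refine Finset.sum_congr rfl fun j _ => ?_
      rw [integral_const_mul, integral_mul_const]
    rw [this]
    exact integral_nonneg_of_ae (hF.mono fun a ha => ha.dotProduct_mulVec_nonneg x)

theorem inv_add_mul_one_add_le {p r : ℝ} (hp : 0 < p) (hr : 0 ≤ r) :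
    (p + r)⁻¹ * (1 + r) ≤ 1 + p⁻¹ := by
  rw [inv_mul_le_iff₀ (by linarith)]
  have : p * p⁻¹ = 1 := mul_inv_cancel₀ hp.ne'
  have h2 : 0 ≤ r * p⁻¹ := by positivity
  nlinarith

theorem inv_one_add_sub_one_mul_le {p s : ℝ} (hp : 0 < p) (h0 : 0 ≤ s) (h1 : s ≤ 1) :
    (1 + (p - 1) * s)⁻¹ ≤ 1 + p⁻¹ := by
  rw [inv_le_iff_one_le_mul₀ (one_add_mul_pos (by linarith) h0 h1)]
  have h2 : p⁻¹ * p = 1 := inv_mul_cancel₀ hp.ne'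
  have h3 : 0 ≤ p⁻¹ * (1 - s) := mul_nonneg (inv_nonneg.2 hp.le) (by linarith)
  have h4 : 0 ≤ p * s := by positivity
  linear_combination (h3 + h4) - s * h2

theorem HasPoleMeasure.isStieltjesM {m : ℕ} {t : ℝ} (ht : 0 ≤ t)
    {Y : ℝ → Matrix (Fin m) (Fin m) ℝ} (hY : HasPoleMeasure m t Y) : IsStieltjesM m Y := by
  obtain ⟨P, hP⟩ := hY
  set ρ : Measure (ℝ × (Fin m → Fin m → ℝ)) :=
    (P : Measure (poleResidueSet m)).map Subtype.val with hρ
  have hρP : IsProbabilityMeasure ρ :=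
    Measure.isProbabilityMeasure_map measurable_subtype_coe.aemeasurable
  have hρS : ∀ᵐ x ∂ρ, x ∈ poleResidueSet m := by
    refine (ae_map_iff measurable_subtype_coe.aemeasurable
      (isClosed_poleResidueSet m).measurableSet).2 (ae_of_all _ fun x => x.2)
  set A : Set (ℝ × (Fin m → Fin m → ℝ)) := {x | 0 < x.1} with hA
  have hAm : MeasurableSet A := measurableSet_lt measurable_const measurable_fst
  set g : ℝ × (Fin m → Fin m → ℝ) → ℝ × (Fin m → Fin m → ℝ) :=
    fun x => ((1 - x.1) / x.1, x.2) with hg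
  have hgm : Measurable g := by fun_prop
  set Q := (ρ.restrict A).map g with hQ
  have hps : MeasurableSet {k : Fin m → Fin m → ℝ | (Matrix.of k).PosSemidef} := by
    have hc : IsClosed {k : Fin m → Fin m → ℝ | (Matrix.of k).PosSemidef} :=
      Matrix.isClosed_setOf_posSemidef (Fin m)
    exact hc.measurableSet
  have hset : MeasurableSet {x : ℝ × (Fin m → Fin m → ℝ) |
      0 ≤ x.1 ∧ (Matrix.of x.2).PosSemidef ∧ ∀ i j, |x.2 i j| ≤ 1} := by
    refine (measurable_fst measurableSet_Ici).inter ((measurable_snd hps).inter ?_)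
    have : {x : ℝ × (Fin m → Fin m → ℝ) | ∀ i j, |x.2 i j| ≤ 1}
        = ⋂ i, ⋂ j, {x | |x.2 i j| ≤ 1} := by ext; simp
    change MeasurableSet {x : ℝ × (Fin m → Fin m → ℝ) | ∀ i j, |x.2 i j| ≤ 1}
    rw [this]
    exact MeasurableSet.iInter fun i => MeasurableSet.iInter fun j =>
      measurableSet_le (by fun_prop) measurable_const
  have hQS : ∀ᵐ x ∂Q, 0 ≤ x.1 ∧ (Matrix.of x.2).PosSemidef ∧ ∀ i j, |x.2 i j| ≤ 1 := by
    rw [hQ, ae_map_iff hgm.aemeasurable]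
    · filter_upwards [ae_restrict_of_ae hρS] with x hx
      exact ⟨div_nonneg (by linarith [hx.1.2]) hx.1.1, hx.2.1,
        fun i j => abs_snd_le_one_of_mem_poleResidueSet hx i j⟩
    · exact hset
  have hQae : ∀ᵐ r ∂Q.fst, ∀ᵐ k ∂Q.condKernel r,
      0 ≤ r ∧ (Matrix.of k).PosSemidef ∧ ∀ i j, |k i j| ≤ 1 := by
    apply Measure.ae_ae_of_ae_compProd (p := fun x : ℝ × (Fin m → Fin m → ℝ) =>
      0 ≤ x.1 ∧ (Matrix.of x.2).PosSemidef ∧ ∀ i j, |x.2 i j| ≤ 1)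
    rwa [Q.disintegrate Q.condKernel]
  have hr0 : ∀ᵐ r ∂Q.fst, 0 ≤ r := by
    filter_upwards [hQae] with r hr
    exact hr.exists.choose_spec.1
  set μ := Q.fst.withDensity (fun r => ENNReal.ofReal (1 + r)) with hμ
  have hμac : μ ≪ Q.fst := withDensity_absolutelyContinuous _ _
  set G : ℝ → Matrix (Fin m) (Fin m) ℝ :=
    fun r => Matrix.of fun i j => ∫ k, t * k i j ∂Q.condKernel r with hG
  have hkm : ∀ i j : Fin m, Measurable fun k : Fin m → Fin m → ℝ => t * k i j := by
    intro i j; fun_prop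
  have hres : μ.restrict (Ici 0) = μ := by
    rw [Measure.restrict_eq_self_of_ae_mem]
    exact hμac.ae_le hr0
  refine ⟨Matrix.of fun i j => ∫ x in Aᶜ, t * x.2 i j ∂ρ, μ, G, ?_, ?_, ?_, ?_, ?_, ?_, ?_⟩
  · refine Matrix.posSemidef_of_integral (F := fun x => t • Matrix.of x.2)
      (fun i j => ?_) (ae_restrict_of_ae (hρS.mono fun x hx => hx.2.1.smul ht))
    refine (Integrable.of_bound (C := t) ?_ (hρS.mono fun x hx => ?_)).restrict
    · exact ((hkm i j).comp measurable_snd).aestronglyMeasurable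
    · simp only [Matrix.smul_apply, of_apply, smul_eq_mul, norm_mul, Real.norm_eq_abs,
        abs_of_nonneg ht]
      exact mul_le_of_le_one_right ht (abs_snd_le_one_of_mem_poleResidueSet hx i j)
  · have : ∀ᵐ r ∂μ, 0 ≤ r := hμac.ae_le hr0
    rw [ae_iff] at this
    convert this using 2
    ext r; simp
  · rw [hres, hμ, lintegral_withDensity_eq_lintegral_mul _ (by fun_prop) (by fun_prop)]
    calc ∫⁻ r, _ ∂Q.fst ≤ ∫⁻ r, 1 ∂Q.fst := by
          refine lintegral_mono_ae (hr0.mono fun r hr => ?_)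
          rw [Pi.mul_apply, ← ENNReal.ofReal_mul (by linarith),
            mul_inv_cancel₀ (by linarith), ENNReal.ofReal_one]
      _ < ⊤ := by simp
  · intro i j
    exact ((hkm i j).stronglyMeasurable.integral_kernel (κ := Q.condKernel)).measurable
  · refine hμac.ae_le (hQae.mono fun r hr => ?_)
    refine Matrix.posSemidef_of_integral (F := fun k => t • Matrix.of k) (fun i j => ?_)
      (hr.mono fun k hk => hk.2.1.smul ht)
    refine Integrable.of_bound (C := t) (hkm i j).aestronglyMeasurable (hr.mono fun k hk => ?_)
    simp only [Matrix.smul_apply, of_apply, smul_eq_mul, norm_mul, Real.norm_eq_abs,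
      abs_of_nonneg ht]
    exact mul_le_of_le_one_right ht (hk.2.2 i j)
  · refine ⟨t, hμac.ae_le (hQae.mono fun r hr i j => ?_)⟩
    have := norm_integral_le_of_norm_le_const (μ := Q.condKernel r) (f := fun k => t * k i j)
      (C := t) (hr.mono fun k hk => by
        simp only [norm_mul, Real.norm_eq_abs, abs_of_nonneg ht]
        exact mul_le_of_le_one_right ht (hk.2.2 i j))
    simpa [hG] using this
  · intro p hp
    rw [mem_Ioi] at hp
    ext i j
    rw [hP p hp i j, Matrix.add_apply, of_apply, of_apply, hres, hμ,
      integral_withDensity_eq_integral_toReal_smul (by fun_prop) (by simp)]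
    have hQint : Integrable (fun x : ℝ × (Fin m → Fin m → ℝ) =>
        (ENNReal.ofReal (1 + x.1)).toReal * ((p + x.1)⁻¹ * (t * x.2 i j))) Q := by
      refine Integrable.of_bound (C := (1 + p⁻¹) * t) (Measurable.aestronglyMeasurable (by fun_prop))
        (hQS.mono fun x hx => ?_)
      rw [ENNReal.toReal_ofReal (by linarith), norm_mul, norm_mul, norm_mul, Real.norm_eq_abs,
        Real.norm_eq_abs, Real.norm_eq_abs, Real.norm_eq_abs, abs_of_nonneg ht,
        abs_of_nonneg (by linarith : 0 ≤ 1 + x.1),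
        abs_of_nonneg (inv_nonneg.2 (by linarith : 0 ≤ p + x.1)), ← mul_assoc, mul_comm (1 + x.1)]
      gcongr
      · exact inv_add_mul_one_add_le hp hx.1
      · exact mul_le_of_le_one_right ht (hx.2.2 i j)
    have h1 : ∫ r, (ENNReal.ofReal (1 + r)).toReal • ((p + r)⁻¹ * G r i j) ∂Q.fst
        = ∫ x in A, t * ((1 + (p - 1) * x.1)⁻¹ * x.2 i j) ∂ρ := by
      simp only [hG, of_apply, smul_eq_mul, ← integral_const_mul]
      rw [Measure.integral_condKernel hQint, hQ, integral_map hgm.aemeasurable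
        hQint.aestronglyMeasurable]
      refine setIntegral_congr_ae hAm (hρS.mono fun x hx hxA => ?_)
      rw [hA, mem_ofPred_eq] at hxA
      have h2 : (1 + (p - 1) * x.1) ≠ 0 :=
        (one_add_mul_pos (by linarith) hx.1.1 hx.1.2).ne'
      have h3 : 1 + (1 - x.1) / x.1 = 1 / x.1 := by field_simp; ring
      have h4 : p + (1 - x.1) / x.1 = (1 + (p - 1) * x.1) / x.1 := by field_simp; ring
      simp only [hg]
      rw [h3, h4, ENNReal.toReal_ofReal (by positivity)]
      field_simp
    have h2 : ∫ x in Aᶜ, t * x.2 i j ∂ρ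
        = ∫ x in Aᶜ, t * ((1 + (p - 1) * x.1)⁻¹ * x.2 i j) ∂ρ := by
      refine setIntegral_congr_ae hAm.compl (hρS.mono fun x hx hxA => ?_)
      rw [hA, mem_compl_iff, mem_ofPred_eq, not_lt] at hxA
      rw [le_antisymm hxA hx.1.1]
      simp
    have hm : Measurable fun x : ℝ × (Fin m → Fin m → ℝ) =>
        t * ((1 + (p - 1) * x.1)⁻¹ * x.2 i j) := by fun_prop
    have hint : Integrable (fun x : ℝ × (Fin m → Fin m → ℝ) =>
        t * ((1 + (p - 1) * x.1)⁻¹ * x.2 i j)) ρ := by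
      refine Integrable.of_bound (C := t * (1 + p⁻¹)) hm.aestronglyMeasurable
        (hρS.mono fun x hx => ?_)
      have h3 := one_add_mul_pos (by linarith : -1 < p - 1) hx.1.1 hx.1.2
      rw [norm_mul, norm_mul, Real.norm_eq_abs, Real.norm_eq_abs, Real.norm_eq_abs,
        abs_of_nonneg ht, abs_of_nonneg (inv_nonneg.2 h3.le)]
      refine mul_le_mul_of_nonneg_left ?_ ht
      exact (mul_le_of_le_one_right (inv_nonneg.2 h3.le)
        (abs_snd_le_one_of_mem_poleResidueSet hx i j)).trans
        (inv_one_add_sub_one_mul_le hp hx.1.1 hx.1.2)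
    rw [h1, h2, add_comm, integral_add_compl hAm hint, ← integral_const_mul, hρ,
      integral_map measurable_subtype_coe.aemeasurable hm.aestronglyMeasurable]

theorem hasPoleMeasure_inv_sum {m : ℕ} (hm : 0 < m) {ι : Type*} [Fintype ι] [DecidableEq ι]
    (s : ι → ℝ) (hs : ∀ i, 0 < s i ∧ s i ≤ 1) (K : ι → Matrix (Fin m) (Fin m) ℝ)
    (hK : ∀ i, (K i).PosSemidef) (hsum : IsUnit (∑ i, K i)) :
    HasPoleMeasure m (∑ i, K i)⁻¹.trace
      (fun p => (p • ∑ i, (1 + (p - 1) * s i)⁻¹ • K i)⁻¹) := by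
  have : Nonempty (Fin m) := ⟨⟨0, hm⟩⟩
  choose N v hv using fun i => posSemidef_iff_eq_sum_vecMulVec.1 (hK i)
  set V : Matrix (Σ i, Fin (N i)) (Fin m) ℝ := Matrix.of fun x b => v x.1 x.2 b with hV
  have hVD : ∀ d : ι → ℝ, Vᵀ * diagonal (fun x : Σ i, Fin (N i) => d x.1) * V = ∑ i, d i • K i := by
    intro d
    ext a b
    rw [Matrix.mul_apply]
    simp only [mul_diagonal, Fintype.sum_sigma, Matrix.sum_apply, hv,
      Matrix.smul_apply, smul_eq_mul, Finset.mul_sum, hV, of_apply, transpose_apply,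
      vecMulVec_apply, star_trivial]
    exact Finset.sum_congr rfl fun i _ => Finset.sum_congr rfl fun c _ => by ring
  have hVV : Vᵀ * V = ∑ i, K i := by simpa using hVD 1
  obtain ⟨l, L₀, X, hl, hL₀, hY⟩ :=
    inv_transpose_mul_diagonal_mul (fun x : Σ i, Fin (N i) => s x.1) (fun x => hs x.1) V (hVV ▸ hsum)
  simp only [fun p : ℝ => hVD fun i => (1 + (p - 1) * s i)⁻¹] at hY
  set L : Option (Σ i, Fin (N i)) → Matrix (Fin m) (Fin m) ℝ := fun k =>
    k.elim L₀ fun k => vecMulVec (fun a => X a k) (fun a => X a k) with hL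
  have hsumL : ∀ p : ℝ, 0 < p → (p • ∑ i, (1 + (p - 1) * s i)⁻¹ • K i)⁻¹
      = ∑ k, (1 + (p - 1) * (k.elim 0 l : ℝ))⁻¹ • L k := by
    intro p hp
    rw [hY p hp, Fintype.sum_option]
    simp only [hL, Option.elim]
    congr 1
    · simp
    · ext a b
      rw [Matrix.mul_apply]
      simp only [mul_diagonal, Matrix.sum_apply, Matrix.smul_apply, smul_eq_mul,
        transpose_apply, vecMulVec_apply]
      exact Finset.sum_congr rfl fun i _ => by ring
  have htr : ∑ k, (L k).trace = (∑ i, K i)⁻¹.trace := by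
    have := hsumL 1 one_pos
    simp only [sub_self, zero_mul, add_zero, inv_one, one_smul] at this
    rw [this, trace_sum]
  have hpd : (∑ i, K i).PosDef :=
    (posSemidef_sum _ fun i _ => hK i).posDef_iff_isUnit.2 hsum
  obtain ⟨P, hP⟩ := hasPoleMeasure_sum hm hpd.inv.trace_pos (fun k => k.elim 0 l)
    (fun k => by cases k with
      | none => simp
      | some k => exact ⟨(hl k).1.le, (hl k).2⟩) L
    (fun k => by cases k with
      | none => exact hL₀
      | some k => simpa [hL] using posSemidef_vecMulVec_self_star fun a => X a k) htr
  exact ⟨P, fun p hp i j => by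
    rw [← hP p hp i j]
    exact congrFun (congrFun (hsumL p hp) i) j⟩

theorem integral_comp_natCeil_mul {α : Type*} [MeasurableSpace α] {μ : Measure α} {f w : α → ℝ}
    (hw : Measurable w) (h0 : ∀ᵐ a ∂μ, 0 < w a ∧ w a ≤ 1) (hf : Integrable f μ) (n : ℕ)
    (φ : ℕ → ℝ) :
    ∫ a, φ ⌈(n + 1 : ℝ) * w a⌉₊ * f a ∂μ
      = ∑ k : Fin (n + 1), φ (k + 1) * ∫ a in {a | ⌈(n + 1 : ℝ) * w a⌉₊ = k + 1}, f a ∂μ := by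
  have hE : ∀ k : ℕ, MeasurableSet {a | ⌈(n + 1 : ℝ) * w a⌉₊ = k + 1} := fun k =>
    (Nat.measurable_ceil.comp (hw.const_mul _)) (measurableSet_singleton (k + 1))
  simp only [← integral_indicator (hE _), ← integral_const_mul]
  rw [← integral_finsetSum _ fun k _ => (hf.indicator (hE _)).const_mul _]
  refine integral_congr_ae (h0.mono fun a ha => ?_)
  have h1 : 0 < ⌈(n + 1 : ℝ) * w a⌉₊ := Nat.ceil_pos.2 (mul_pos (by positivity) ha.1)
  have h2 : ⌈(n + 1 : ℝ) * w a⌉₊ ≤ n + 1 := by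
    apply Nat.ceil_le.2
    push_cast
    exact mul_le_of_le_one_right (by positivity) ha.2
  obtain ⟨k, hk⟩ := Nat.exists_eq_succ_of_ne_zero h1.ne'
  simp only [indicator_apply, mem_ofPred_eq]
  rw [Finset.sum_eq_single (⟨k, by omega⟩ : Fin (n + 1))]
  · simp [hk]
  · intro b _ hb
    rw [if_neg, mul_zero]
    intro h
    apply hb
    ext
    simp
    omega
  · simp

theorem tendsto_natCeil_succ_mul_div {x : ℝ} (hx : 0 ≤ x) :
    Tendsto (fun n : ℕ => (⌈(n + 1 : ℝ) * x⌉₊ : ℝ) / (n + 1)) atTop (𝓝 x) := by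
  have := (tendsto_nat_ceil_mul_div_atTop hx).comp
    (tendsto_natCast_atTop_atTop.comp (tendsto_add_atTop_nat 1))
  simpa [Function.comp_def, mul_comm x] using this

/-- If `Z` is an `S₊`-valued complete Bernstein function on `(0,∞)` that
does not vanish identically and `Z(p)` is invertible for every `p > 0`, then
`p ↦ Z(p)⁻¹` is an `S₊`-valued Stieltjes function. -/
theorem inv_CBF_isStieltjes (m : ℕ) (Z : ℝ → Matrix (Fin m) (Fin m) ℝ)
    (hZ : IsCBFM m Z)
    (hnz : ¬ ∀ p ∈ Set.Ioi (0:ℝ), Z p = 0)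
    (hinv : ∀ p ∈ Set.Ioi (0:ℝ), IsUnit (Z p)) :
    IsStieltjesM m (fun p => (Z p)⁻¹) := by
  have hm : 0 < m := by
    rcases Nat.eq_zero_or_pos m with rfl | h
    · exact absurd (fun p _ => Subsingleton.elim _ _) hnz
    · exact h
  obtain ⟨B, ν, H, hB, -, hν, hHm, hHp, ⟨M, hM⟩, hZ⟩ := hZ
  set ν' := ν.restrict (Ici 0) with hν'
  set w : ℝ → ℝ := fun r => (1 + r)⁻¹ with hw
  have hwm : Measurable w := by fun_prop
  have hr : ∀ᵐ r ∂ν', 0 ≤ r := ae_restrict_mem measurableSet_Ici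
  have hw01 : ∀ᵐ r ∂ν', 0 < w r ∧ w r ≤ 1 := hr.mono fun r hr =>
    ⟨inv_pos.2 (by linarith), inv_le_one_of_one_le₀ (by linarith)⟩
  have hwint : Integrable w ν' := by
    refine ⟨hwm.aestronglyMeasurable, ?_⟩
    rw [hasFiniteIntegral_iff_ofReal (hw01.mono fun r h => h.1.le)]
    exact hν
  have hHp' : ∀ᵐ r ∂ν', (H r).PosSemidef := ae_restrict_of_ae hHp
  have hM' : ∀ᵐ r ∂ν', ∀ i j, |H r i j| ≤ M := ae_restrict_of_ae hM
  have hfint : ∀ i j, Integrable (fun r => w r * H r i j) ν' := fun i j =>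
    hwint.mul_bdd (c := M) (hHm i j).aestronglyMeasurable (hM'.mono fun r h => h i j)
  set K : (n : ℕ) → Fin (n + 1) → Matrix (Fin m) (Fin m) ℝ := fun n k =>
    (if k = 0 then B else 0) + Matrix.of fun i j =>
      ∫ r in {r | ⌈(n + 1 : ℝ) * w r⌉₊ = (k : ℕ) + 1}, w r * H r i j ∂ν' with hK
  have hKp : ∀ n k, (K n k).PosSemidef := by
    intro n k
    refine PosSemidef.add ?_ (Matrix.posSemidef_of_integral (F := fun r => w r • H r)
      (fun i j => (hfint i j).restrict) (ae_restrict_of_ae ?_))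
    · split_ifs
      exacts [hB, PosSemidef.zero]
    · filter_upwards [hHp', hw01] with r h1 h2 using h1.smul h2.1.le
  have hsumK : ∀ (n : ℕ) (φ : ℝ → ℝ), ∑ k : Fin (n + 1), φ (((k : ℕ) + 1) / (n + 1)) • K n k
      = φ (1 / (n + 1)) • B + Matrix.of fun i j =>
        ∫ r, φ (⌈(n + 1 : ℝ) * w r⌉₊ / (n + 1)) * (w r * H r i j) ∂ν' := by
    intro n φ
    ext i j
    have := integral_comp_natCeil_mul hwm hw01 (hfint i j) n fun k => φ (k / (n + 1))
    rw [Matrix.add_apply, of_apply, this]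
    simp only [hK, Matrix.sum_apply, Matrix.smul_apply, Matrix.add_apply, of_apply, smul_eq_mul,
      mul_add, Finset.sum_add_distrib]
    congr 1
    · rw [Finset.sum_eq_single 0]
      · simp
      · intro k _ hk; simp [hk]
      · simp
    · push_cast; rfl
  have hZ' : ∀ p : ℝ, 0 < p → Z p = p • (B + Matrix.of fun i j =>
      ∫ r, (1 + (p - 1) * w r)⁻¹ * (w r * H r i j) ∂ν') := by
    intro p hp
    rw [hZ p (mem_Ioi.2 hp), smul_add]
    congr 1
    ext i j
    rw [Matrix.smul_apply, of_apply, of_apply, smul_eq_mul, ← integral_const_mul]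
    refine integral_congr_ae (hr.mono fun r hr => ?_)
    have h1 : (1 + r) ≠ 0 := by linarith
    have h2 : (p + r) ≠ 0 := by linarith
    have h3 : 1 + (p - 1) * (1 + r)⁻¹ = (p + r) * (1 + r)⁻¹ := by field_simp; ring
    simp only [hw, h3]
    field_simp
  have hsum1 : ∀ n, ∑ k, K n k = Z 1 := by
    intro n
    have := hsumK n fun _ => 1
    simpa [hZ' 1 one_pos] using this
  have hu1 : IsUnit (Z 1) := hinv 1 (mem_Ioi.2 one_pos)
  have hZ1 : (Z 1).PosDef := by
    rw [← hsum1 0] at hu1 ⊢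
    exact (posSemidef_sum _ fun k _ => hKp 0 k).posDef_iff_isUnit.2 hu1
  refine HasPoleMeasure.isStieltjesM (t := (Z 1)⁻¹.trace) hZ1.inv.posSemidef.trace_nonneg ?_
  refine HasPoleMeasure.of_tendsto (Ys := fun n p =>
    (p • ∑ k : Fin (n + 1), (1 + (p - 1) * (((k : ℕ) + 1) / (n + 1)))⁻¹ • K n k)⁻¹)
    (fun n => ?_) fun p hp => ?_
  · rw [← hsum1 n]
    refine hasPoleMeasure_inv_sum hm _ (fun k => ⟨by positivity, ?_⟩) _ (hKp n) (hsum1 n ▸ hu1)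
    rw [div_le_one (by positivity)]
    exact_mod_cast k.2
  · have hu : (Z p).det ≠ 0 := ((isUnit_iff_isUnit_det _).1 (hinv p (mem_Ioi.2 hp))).ne_zero
    have hcont : ContinuousAt (fun A : Matrix (Fin m) (Fin m) ℝ => A⁻¹) (Z p) :=
      continuousAt_matrix_inv _ (by simpa using continuousAt_inv₀ hu)
    refine hcont.tendsto.comp ?_
    rw [hZ' p hp]
    refine Tendsto.const_smul ?_ p
    have hrw := fun n => hsumK n fun s => (1 + (p - 1) * s)⁻¹
    simp only [hrw]
    refine Tendsto.add ?_ ?_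
    · have h1 : Tendsto (fun n : ℕ => (1 + (p - 1) * (1 / ((n : ℝ) + 1)))⁻¹) atTop (𝓝 1) := by
        have := ((tendsto_one_div_add_atTop_nhds_zero_nat (𝕜 := ℝ)).const_mul (p - 1)).const_add 1
        simpa using this.inv₀ (by simp)
      simpa using h1.smul_const B
    · refine tendsto_pi_nhds.2 fun i => tendsto_pi_nhds.2 fun j => ?_
      refine tendsto_integral_of_dominated_convergence
        (fun r => (1 + p⁻¹) * ‖w r * H r i j‖) (fun n => ?_) ((hfint i j).norm.const_mul _)
        (fun n => ?_) ?_
      · have := hHm i j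
        have hc : Measurable fun r => (⌈(n + 1 : ℝ) * w r⌉₊ : ℝ) :=
          measurable_from_nat.comp (Nat.measurable_ceil.comp (hwm.const_mul _))
        exact Measurable.aestronglyMeasurable (by fun_prop)
      · filter_upwards [hw01] with r h
        have h0 : 0 ≤ (⌈(n + 1 : ℝ) * w r⌉₊ : ℝ) / (n + 1) := by positivity
        have h1 : (⌈(n + 1 : ℝ) * w r⌉₊ : ℝ) / (n + 1) ≤ 1 := by
          rw [div_le_one (by positivity)]
          have : ⌈(n + 1 : ℝ) * w r⌉₊ ≤ n + 1 := by
            apply Nat.ceil_le.2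
            push_cast
            exact mul_le_of_le_one_right (by positivity) h.2
          exact_mod_cast this
        rw [norm_mul, Real.norm_eq_abs, abs_of_nonneg
          (inv_nonneg.2 (one_add_mul_pos (by linarith) h0 h1).le)]
        exact mul_le_mul_of_nonneg_right (inv_one_add_sub_one_mul_le hp h0 h1) (norm_nonneg _)
      · filter_upwards [hw01] with r h
        have h1 := ((tendsto_natCeil_succ_mul_div h.1.le).const_mul (p - 1)).const_add 1
        exact (h1.inv₀ (one_add_mul_pos (by linarith) h.1.le h.2).ne').mul_const _
end
end

section
/- If Y is an S₊-valued Stieltjes function on (0,∞) that does not vanish identically and Y(p) is invertible for every p > 0, then the function p ↦ Y(p)^{−1} is an S₊-valued complete Bernstein function (CBF). -/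
open MeasureTheory Set Filter Topology Matrix

noncomputable section

theorem inv_add_transpose_mul_diagonal_mul {m : ℕ} {κ : Type*} [Fintype κ] [DecidableEq κ]
    {C : Matrix (Fin m) (Fin m) ℝ} (hC : C.PosDef) (V : Matrix κ (Fin m) ℝ) {r : κ → ℝ}
    (hr : ∀ k, 0 < r k) :
    ∃ (d : κ → ℝ) (Q : Matrix κ (Fin m) ℝ), (∀ k, 0 < d k) ∧ ∀ p : ℝ, 0 ≤ p →
      (C + Vᵀ * diagonal (fun k => (p + r k)⁻¹) * V)⁻¹ =
        C⁻¹ - Qᵀ * diagonal (fun k => (p + d k)⁻¹) * Q := by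
  have hD : (diagonal r + V * C⁻¹ * Vᵀ).PosDef :=
    (PosDef.diagonal hr).add_posSemidef
      (by simpa using hC.inv.posSemidef.mul_mul_conjTranspose_same V)
  set d := hD.1.eigenvalues with hd
  set U : Matrix κ κ ℝ := (hD.1.eigenvectorUnitary : Matrix κ κ ℝ) with hU
  have hUU : U * Uᵀ = 1 := by
    have := Unitary.coe_mul_star_self hD.1.eigenvectorUnitary
    simpa [star_eq_conjTranspose] using this
  have hUU' : Uᵀ * U = 1 := by
    have := Unitary.coe_star_mul_self hD.1.eigenvectorUnitary
    simpa [star_eq_conjTranspose] using this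
  have hspec : diagonal r + V * C⁻¹ * Vᵀ = U * diagonal d * Uᵀ := by
    have := hD.1.spectral_theorem
    rw [Unitary.conjStarAlgAut_apply] at this
    simpa [star_eq_conjTranspose, Function.comp_def] using this
  have hdpos : ∀ k, 0 < d k := fun k => hD.eigenvalues_pos k
  have hCt : (C⁻¹)ᵀ = C⁻¹ := by simpa using hC.inv.1.eq
  refine ⟨d, Uᵀ * V * C⁻¹, hdpos, fun p hp => ?_⟩
  have hpr : ∀ k, 0 < p + r k := fun k => add_pos_of_nonneg_of_pos hp (hr k)
  have hpd : ∀ k, 0 < p + d k := fun k => add_pos_of_nonneg_of_pos hp (hdpos k)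
  have hdiag : (diagonal (fun k => (p + r k)⁻¹))⁻¹ = diagonal (fun k => p + r k) := by
    apply inv_eq_right_inv
    rw [diagonal_mul_diagonal, ← diagonal_one]
    congr 1
    ext k
    exact inv_mul_cancel₀ (hpr k).ne'
  have hmid : diagonal (fun k => p + r k) + V * C⁻¹ * Vᵀ =
      U * diagonal (fun k => p + d k) * Uᵀ := by
    have h1 : diagonal (fun k => p + r k) = p • (1 : Matrix κ κ ℝ) + diagonal r := by
      rw [smul_one_eq_diagonal, diagonal_add]
    have h2 : diagonal (fun k => p + d k) = p • (1 : Matrix κ κ ℝ) + diagonal d := by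
      rw [smul_one_eq_diagonal, diagonal_add]
    rw [h1, h2, add_assoc, hspec, mul_add, add_mul]
    simp [hUU]
  have hinv : (U * diagonal (fun k => p + d k) * Uᵀ)⁻¹ =
      U * diagonal (fun k => (p + d k)⁻¹) * Uᵀ := by
    apply inv_eq_right_inv
    calc U * diagonal (fun k => p + d k) * Uᵀ * (U * diagonal (fun k => (p + d k)⁻¹) * Uᵀ)
        = U * diagonal (fun k => p + d k) * (Uᵀ * U) * diagonal (fun k => (p + d k)⁻¹) * Uᵀ := by
          simp only [Matrix.mul_assoc]
      _ = U * (diagonal (fun k => p + d k) * diagonal (fun k => (p + d k)⁻¹)) * Uᵀ := by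
          simp only [hUU', Matrix.mul_one, Matrix.mul_assoc]
      _ = 1 := by
          rw [diagonal_mul_diagonal]
          have : (fun k => (p + d k) * (p + d k)⁻¹) = fun _ => (1 : ℝ) := by
            ext k
            exact mul_inv_cancel₀ (hpd k).ne'
          rw [this, diagonal_one, Matrix.mul_one, hUU]
  have hdiagU : IsUnit (diagonal (fun k => (p + r k)⁻¹)) :=
    (PosDef.diagonal fun k => inv_pos.2 (hpr k)).isUnit
  have hmidU : IsUnit ((diagonal (fun k => (p + r k)⁻¹))⁻¹ + V * C⁻¹ * Vᵀ) := by
    rw [hdiag]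
    exact ((PosDef.diagonal hpr).add_posSemidef
      (by simpa using hC.inv.posSemidef.mul_mul_conjTranspose_same V)).isUnit
  rw [add_mul_mul_inv_eq_sub _ _ _ _ hC.isUnit hdiagU hmidU, hdiag, hmid, hinv]
  simp only [transpose_mul, hCt, transpose_transpose, Matrix.mul_assoc]

/-- The kernel `p / (p s + 1 - s)`, which for `s = 1 / (1 + r)` is `p (1 + r) / (p + r)`. -/
noncomputable def cbfKernel (p s : ℝ) : ℝ := p / (p * s + (1 - s))

theorem transpose_mul_diagonal_mul_eq_sum {m : ℕ} {κ : Type*} [Fintype κ] [DecidableEq κ]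
    (Q : Matrix κ (Fin m) ℝ) (f : κ → ℝ) :
    Qᵀ * diagonal f * Q = ∑ k, f k • vecMulVec (Q k) (Q k) := by
  ext i j
  rw [Matrix.mul_apply, Matrix.sum_apply]
  simp only [mul_diagonal, transpose_apply, Matrix.smul_apply, vecMulVec_apply, smul_eq_mul]
  exact Finset.sum_congr rfl fun k _ => by ring

theorem inv_rational_stieltjes_eq_sum {m : ℕ} {κ : Type} [Fintype κ] [DecidableEq κ]
    {C : Matrix (Fin m) (Fin m) ℝ} (hC : C.PosDef) (V : Matrix κ (Fin m) ℝ) {r : κ → ℝ}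
    (hr : ∀ k, 0 < r k) :
    ∃ (n : ℕ) (s : Fin n ⊕ κ → unitInterval) (u : Fin n ⊕ κ → Fin m → ℝ), ∀ p : ℝ, 0 < p →
      (C + Vᵀ * diagonal (fun k => (p + r k)⁻¹) * V)⁻¹ =
        ∑ l, cbfKernel p (s l) • vecMulVec (u l) (u l) := by
  obtain ⟨d, Q, hd, h⟩ := inv_add_transpose_mul_diagonal_mul hC V hr
  have h0 : (C⁻¹ - Qᵀ * diagonal (fun k => (0 + d k)⁻¹) * Q).PosSemidef := by
    rw [← h 0 le_rfl]
    refine (hC.add_posSemidef ?_).inv.posSemidef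
    have := PosSemidef.diagonal (d := fun k => (0 + r k)⁻¹)
      (fun k => (inv_pos.2 (by simpa using hr k)).le)
    simpa using this.conjTranspose_mul_mul_same V
  obtain ⟨n, v, hv⟩ := posSemidef_iff_eq_sum_vecMulVec.1 h0
  refine ⟨n, Sum.elim (fun _ => 1) (fun k => ⟨(1 + d k)⁻¹, (inv_pos.2 (by linarith [hd k])).le,
      inv_le_one_of_one_le₀ (by linarith [hd k])⟩),
    Sum.elim v (fun k => (Real.sqrt (d k * (1 + d k)))⁻¹ • Q k), fun p hp => ?_⟩
  rw [h p hp.le, Fintype.sum_sum_type]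
  have h1 : ∑ x : Fin n, cbfKernel p (1 : unitInterval) • vecMulVec (v x) (v x) =
      C⁻¹ - Qᵀ * diagonal (fun k => (0 + d k)⁻¹) * Q := by
    rw [hv]
    simp [cbfKernel, hp.ne']
  simp only [Sum.elim_inl, Sum.elim_inr, h1]
  suffices hsum : Qᵀ * diagonal (fun k => (0 + d k)⁻¹) * Q =
      Qᵀ * diagonal (fun k => (p + d k)⁻¹) * Q + ∑ k, cbfKernel p (1 + d k)⁻¹ •
        vecMulVec ((Real.sqrt (d k * (1 + d k)))⁻¹ • Q k)
          ((Real.sqrt (d k * (1 + d k)))⁻¹ • Q k) by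
    rw [hsum]
    abel
  simp only [transpose_mul_diagonal_mul_eq_sum, vecMulVec_smul, smul_vecMulVec, smul_smul,
    zero_add, ← Finset.sum_add_distrib, ← add_smul]
  refine Finset.sum_congr rfl fun k _ => ?_
  congr 1
  have := hd k
  have hs : Real.sqrt (d k * (1 + d k)) ^ 2 = d k * (1 + d k) := Real.sq_sqrt (by positivity)
  have e : cbfKernel p (1 + d k)⁻¹ = p * (1 + d k) / (p + d k) := by
    unfold cbfKernel
    have : p * (1 + d k)⁻¹ + (1 - (1 + d k)⁻¹) = (p + d k) / (1 + d k) := by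
      field_simp; ring
    rw [this]
    field_simp
  rw [e, ← mul_inv, ← sq, hs]
  field_simp
  ring

theorem exists_probabilityMeasure_integral_eq_sum {m : ℕ} {ι : Type*} [Fintype ι]
    (s : ι → unitInterval) (u : ι → Fin m → ℝ) {c : ℝ} (hc : 0 ≤ c)
    (hu : ∑ l, ∑ i, u l i ^ 2 ≤ c ^ 2) :
    ∃ ρ : ProbabilityMeasure (unitInterval × (Fin m → Icc (-c) c)),
      ∀ (F : unitInterval → ℝ) (i j : Fin m),
        ∫ z, F z.1 * ((z.2 i : ℝ) * z.2 j) ∂(ρ : Measure (unitInterval × (Fin m → Icc (-c) c))) =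
          ∑ l, F (s l) * (u l i * u l j) := by
  set τ : ℝ := ∑ l, ∑ i, u l i ^ 2 with hτ
  have hl0 : ∀ l, 0 ≤ ∑ i, u l i ^ 2 := fun l => Finset.sum_nonneg fun i _ => sq_nonneg _
  have hτ0 : 0 ≤ τ := Finset.sum_nonneg fun l _ => hl0 l
  have hz : ∀ l, ∑ i, u l i ^ 2 = 0 → ∀ i, u l i = 0 := fun l h i => by
    have := (Finset.sum_eq_zero_iff_of_nonneg fun i _ => sq_nonneg (u l i)).1 h i
      (Finset.mem_univ _)
    simpa using this
  rcases hτ0.eq_or_lt with h | h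
  · have hu0 : ∀ l i, u l i = 0 := fun l => hz l <|
      (Finset.sum_eq_zero_iff_of_nonneg fun l _ => hl0 l).1 h.symm l (Finset.mem_univ _)
    refine ⟨⟨Measure.dirac (0, fun _ => ⟨0, by simpa using hc⟩), inferInstance⟩,
      fun F i j => ?_⟩
    simp [hu0]
  · set w : ι → ℝ := fun l => (∑ i, u l i ^ 2) / τ with hw
    have hw0 : ∀ l, 0 ≤ w l := fun l => div_nonneg (hl0 l) hτ0
    have hle : ∀ l i, u l i ^ 2 ≤ w l * c ^ 2 := fun l i => by
      calc u l i ^ 2 ≤ ∑ i, u l i ^ 2 :=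
            Finset.single_le_sum (f := fun i => u l i ^ 2) (fun i _ => sq_nonneg _) (Finset.mem_univ i)
        _ = w l * τ := by simp only [hw]; field_simp
        _ ≤ w l * c ^ 2 := by gcongr
    have hx : ∀ l i, u l i / Real.sqrt (w l) ∈ Icc (-c) c := fun l i => by
      rw [mem_Icc, ← abs_le]
      apply abs_le_of_sq_le_sq _ hc
      rw [div_pow, Real.sq_sqrt (hw0 l)]
      exact div_le_of_le_mul₀ (hw0 l) (sq_nonneg c) (by linarith [hle l i])
    let x : ι → unitInterval × (Fin m → Icc (-c) c) := fun l =>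
      (s l, fun i => ⟨u l i / Real.sqrt (w l), hx l i⟩)
    refine ⟨⟨∑ l, ENNReal.ofReal (w l) • Measure.dirac (x l), ⟨?_⟩⟩, fun F i j => ?_⟩
    · simp only [Measure.coe_finsetSum, Finset.sum_apply, Measure.smul_apply, measure_univ,
        smul_eq_mul, mul_one]
      rw [← ENNReal.ofReal_sum_of_nonneg fun l _ => hw0 l, ← Finset.sum_div, div_self h.ne',
        ENNReal.ofReal_one]
    · simp only [ProbabilityMeasure.coe_mk]
      rw [integral_finsetSum_measure]
      · refine Finset.sum_congr rfl fun l _ => ?_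
        rw [integral_smul_measure, integral_dirac, ENNReal.toReal_ofReal (hw0 l), smul_eq_mul]
        simp only [x]
        rcases (hw0 l).eq_or_lt with h' | h'
        · have : ∀ i, u l i = 0 := fun i => by
            have := hle l i
            rw [← h'] at this
            nlinarith [sq_nonneg (u l i)]
          simp [this]
        · have : Real.sqrt (w l) ^ 2 = w l := Real.sq_sqrt h'.le
          have h2 : Real.sqrt (w l) ≠ 0 := (Real.sqrt_pos.2 h').ne'
          field_simp
          rw [this]
          ring
      · intro l _
        exact (integrable_dirac (by simp [ENNReal.mul_lt_top])).smul_measure (by simp)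

theorem continuous_cbfKernel {p : ℝ} (hp : 0 < p) :
    Continuous fun s : unitInterval => cbfKernel p s := by
  unfold cbfKernel
  refine Continuous.div (by fun_prop) (by fun_prop) fun s => ?_
  have h0 := s.2.1
  have h1 := s.2.2
  rcases h0.eq_or_lt with h | h
  · simp [← h]
  · nlinarith [mul_pos hp h]

theorem continuous_cbfKernel_mul_mul {m : ℕ} {c p : ℝ} (hp : 0 < p) (i j : Fin m) :
    Continuous fun z : unitInterval × (Fin m → Icc (-c) c) =>
      cbfKernel p z.1 * ((z.2 i : ℝ) * z.2 j) :=
  ((continuous_cbfKernel hp).comp continuous_fst).mul (by fun_prop)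

theorem exists_probabilityMeasure_integral_cbfKernel_of_tendsto {m : ℕ} {c : ℝ}
    {Z : ℕ → ℝ → Matrix (Fin m) (Fin m) ℝ} {W : ℝ → Matrix (Fin m) (Fin m) ℝ}
    (hZ : ∀ᶠ n in atTop, ∃ ρ : ProbabilityMeasure (unitInterval × (Fin m → Icc (-c) c)),
      ∀ p, 0 < p → ∀ i j, Z n p i j = ∫ z, cbfKernel p z.1 * ((z.2 i : ℝ) * z.2 j)
        ∂(ρ : Measure (unitInterval × (Fin m → Icc (-c) c))))
    (hW : ∀ p, 0 < p → ∀ i j, Tendsto (fun n => Z n p i j) atTop (𝓝 (W p i j))) :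
    ∃ ρ : ProbabilityMeasure (unitInterval × (Fin m → Icc (-c) c)),
      ∀ p, 0 < p → ∀ i j, W p i j = ∫ z, cbfKernel p z.1 * ((z.2 i : ℝ) * z.2 j)
        ∂(ρ : Measure (unitInterval × (Fin m → Icc (-c) c))) := by
  obtain ⟨ρ, hρ⟩ := hZ.choice
  obtain ⟨ρ', -, h'⟩ := isCompact_univ.ultrafilter_le_nhds
    ((Ultrafilter.of (atTop : Filter ℕ)).map ρ) (by simp)
  have hle := Ultrafilter.of_le (atTop : Filter ℕ)
  have hT : Tendsto ρ (Ultrafilter.of (atTop : Filter ℕ)) (𝓝 ρ') := h'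
  refine ⟨ρ', fun p hp i j => ?_⟩
  have h1 := ProbabilityMeasure.tendsto_iff_forall_integral_tendsto.1 hT
    (BoundedContinuousFunction.mkOfCompact ⟨_, continuous_cbfKernel_mul_mul hp i j⟩)
  refine tendsto_nhds_unique ((hW p hp i j).mono_left hle) (h1.congr' ?_)
  filter_upwards [hρ.filter_mono hle] with n hn
  exact (hn p hp i j).symm

theorem posSemidef_integral_mul {α : Type*} [MeasurableSpace α] {μ : Measure α} {m : ℕ}
    {x : Fin m → α → ℝ} (hx : ∀ i j, Integrable (fun a => x i a * x j a) μ) :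
    (Matrix.of fun i j => ∫ a, x i a * x j a ∂μ).PosSemidef := by
  refine PosSemidef.of_dotProduct_mulVec_nonneg ?_ fun v => ?_
  · ext i j
    simp [mul_comm]
  · have : star v ⬝ᵥ (Matrix.of fun i j => ∫ a, x i a * x j a ∂μ) *ᵥ v =
        ∫ a, (∑ i, v i * x i a) ^ 2 ∂μ := by
      have h : ∀ a, (∑ i, v i * x i a) ^ 2 = ∑ i, ∑ j, v i * v j * (x i a * x j a) := fun a => by
        rw [sq, Finset.sum_mul_sum]
        exact Finset.sum_congr rfl fun i _ => Finset.sum_congr rfl fun j _ => by ring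
      simp_rw [h]
      rw [integral_finsetSum _ fun i _ => integrable_finsetSum _ fun j _ =>
        (hx i j).const_mul _]
      simp only [dotProduct, mulVec, Finset.mul_sum, of_apply, star_trivial]
      refine Finset.sum_congr rfl fun i _ => ?_
      rw [integral_finsetSum _ fun j _ => (hx i j).const_mul _]
      refine Finset.sum_congr rfl fun j _ => ?_
      rw [integral_const_mul]
      ring
    rw [this]
    exact integral_nonneg fun a => sq_nonneg _

theorem abs_mul_le_of_mem_Icc {m : ℕ} {c : ℝ} (x : Fin m → Icc (-c) c) (i j : Fin m) :
    |(x i : ℝ) * x j| ≤ c * c := by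
  rw [abs_mul]
  have h : ∀ i, |(x i : ℝ)| ≤ c := fun i => abs_le.2 (x i).2
  exact mul_le_mul (h i) (h j) (abs_nonneg _) ((abs_nonneg _).trans (h i))

theorem isCBFM_of_eq_integral_cbfKernel {m : ℕ} {c : ℝ} (hc : 0 ≤ c)
    {Z : ℝ → Matrix (Fin m) (Fin m) ℝ}
    (ρ : Measure (unitInterval × (Fin m → Icc (-c) c))) [IsFiniteMeasure ρ]
    (hZ : ∀ p, 0 < p → ∀ i j, Z p i j = ∫ z, cbfKernel p z.1 * ((z.2 i : ℝ) * z.2 j) ∂ρ) :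
    IsCBFM m Z := by
  have : Nonempty (Icc (-c) c) := ⟨⟨0, by simpa using hc⟩⟩
  set S : Set (unitInterval × (Fin m → Icc (-c) c)) := {z | (z.1 : ℝ) ≠ 0} with hS
  have hSm : MeasurableSet S := (measurableSet_singleton (0 : ℝ)).compl.preimage (by fun_prop)
  set g : unitInterval × (Fin m → Icc (-c) c) → ℝ × (Fin m → Icc (-c) c) :=
    fun z => ((1 - z.1) / z.1, z.2) with hg
  have hgm : Measurable g := by fun_prop
  set τ := Measure.map g (ρ.restrict S) with hτ
  have hg0 : ∀ z, 0 ≤ (g z).1 := fun z =>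
    div_nonneg (sub_nonneg.2 z.1.2.2) z.1.2.1
  have hτ0 : ∀ᵐ y ∂τ, 0 ≤ y.1 :=
    (ae_map_iff hgm.aemeasurable (measurableSet_le (by fun_prop) (by fun_prop))).2
      (ae_of_all _ hg0)
  have hf0 : ∀ᵐ r ∂τ.fst, 0 ≤ r :=
    (ae_map_iff measurable_fst.aemeasurable measurableSet_Ici).2 hτ0
  have hwm : Measurable fun r : ℝ => ENNReal.ofReal (1 + r) := by fun_prop
  set ν := τ.fst.withDensity fun r => ENNReal.ofReal (1 + r) with hν
  have hac : ν ≪ τ.fst := withDensity_absolutelyContinuous _ _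
  have hν0 : ∀ᵐ r ∂ν, r ∈ Ici (0 : ℝ) := hac.ae_le hf0
  have hmm : ∀ i j, Measurable fun x : Fin m → Icc (-c) c => (x i : ℝ) * x j := fun i j => by
    fun_prop
  have hint : ∀ r i j, Integrable (fun x : Fin m → Icc (-c) c => (x i : ℝ) * x j)
      (τ.condKernel r) := fun r i j =>
    Integrable.of_bound (hmm i j).aestronglyMeasurable (c * c)
      (ae_of_all _ fun x => abs_mul_le_of_mem_Icc x i j)
  refine ⟨Matrix.of fun i j => ∫ z in Sᶜ, (z.2 i : ℝ) * z.2 j ∂ρ, ν,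
    fun r => Matrix.of fun i j => ∫ x, (x i : ℝ) * x j ∂(τ.condKernel r), ?_, ?_, ?_, ?_, ?_, ?_,
    fun p hp => ?_⟩
  · refine posSemidef_integral_mul (x := fun i (z : unitInterval × (Fin m → Icc (-c) c)) =>
      (z.2 i : ℝ)) fun i j => ?_
    exact Integrable.of_bound ((hmm i j).comp measurable_snd).aestronglyMeasurable (c * c)
      (ae_of_all _ fun x => abs_mul_le_of_mem_Icc x.2 i j)
  · have h := ae_iff.1 hν0
    simpa [Iio, not_le] using h
  · rw [Measure.restrict_eq_self_of_ae_mem hν0, hν,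
      lintegral_withDensity_eq_lintegral_mul _ hwm (by fun_prop)]
    calc _ = ∫⁻ r, 1 ∂τ.fst := by
          refine lintegral_congr_ae ?_
          filter_upwards [hf0] with r hr
          rw [Pi.mul_apply, ← ENNReal.ofReal_mul (by linarith),
            mul_inv_cancel₀ (by linarith), ENNReal.ofReal_one]
      _ < ⊤ := by simp
  · exact fun i j => ((hmm i j).stronglyMeasurable.integral_kernel).measurable
  · exact ae_of_all _ fun r => posSemidef_integral_mul
      (x := fun i (x : Fin m → Icc (-c) c) => (x i : ℝ)) fun i j => hint r i j
  · refine ⟨c * c, ae_of_all _ fun r i j => ?_⟩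
    simpa using norm_integral_le_of_norm_le_const (μ := τ.condKernel r)
      (f := fun x : Fin m → Icc (-c) c => (x i : ℝ) * x j) (C := c * c)
      (ae_of_all _ fun x => abs_mul_le_of_mem_Icc x i j)
  · have hp : 0 < p := hp
    ext i j
    rw [hZ p hp i j, Measure.restrict_eq_self_of_ae_mem hν0, Matrix.add_apply, Matrix.smul_apply,
      of_apply, of_apply]
    have hk : Integrable (fun z : unitInterval × (Fin m → Icc (-c) c) =>
        cbfKernel p z.1 * ((z.2 i : ℝ) * z.2 j)) ρ :=
      (continuous_cbfKernel_mul_mul hp i j).integrable_of_hasCompactSupport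
        (HasCompactSupport.of_compactSpace _)
    set f : ℝ × (Fin m → Icc (-c) c) → ℝ :=
      fun y => (1 + y.1) * (p * (p + y.1)⁻¹) * ((y.2 i : ℝ) * y.2 j) with hf
    have hfm : Measurable f := by fun_prop
    have hfg : ∀ z ∈ S, f (g z) = cbfKernel p z.1 * ((z.2 i : ℝ) * z.2 j) := fun z hz => by
      have hz0 : (0 : ℝ) < z.1 := lt_of_le_of_ne z.1.2.1 (Ne.symm hz)
      have hz1 : (z.1 : ℝ) ≤ 1 := z.1.2.2
      have h3 : 0 < p * z.1 + (1 - z.1) := by nlinarith [mul_pos hp hz0]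
      simp only [hf, hg, cbfKernel]
      congr 1
      have h4 : p + (1 - (z.1 : ℝ)) / z.1 = (p * z.1 + (1 - z.1)) / z.1 := by field_simp
      rw [h4]
      field_simp
      ring
    have hfi : Integrable f τ := by
      rw [hτ, integrable_map_measure hfm.aestronglyMeasurable hgm.aemeasurable]
      refine (hk.mono_measure Measure.restrict_le_self).congr ?_
      filter_upwards [ae_restrict_mem hSm] with z hz
      exact (hfg z hz).symm
    have h1 : ∫ r, p * (p + r)⁻¹ * ∫ x, (x i : ℝ) * x j ∂(τ.condKernel r) ∂ν =
        ∫ z in S, cbfKernel p z.1 * ((z.2 i : ℝ) * z.2 j) ∂ρ := by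
      rw [hν, integral_withDensity_eq_integral_toReal_smul hwm (by simp)]
      calc _ = ∫ r, ∫ x, f (r, x) ∂(τ.condKernel r) ∂τ.fst := by
            refine integral_congr_ae ?_
            filter_upwards [hf0] with r hr
            rw [ENNReal.toReal_ofReal (by linarith), smul_eq_mul, ← mul_assoc,
              ← integral_const_mul]
        _ = ∫ y, f y ∂τ := Measure.integral_condKernel hfi
        _ = ∫ z in S, f (g z) ∂ρ := integral_map hgm.aemeasurable hfm.aestronglyMeasurable
        _ = _ := setIntegral_congr_fun hSm hfg
    have h2 : p * ∫ z in Sᶜ, (z.2 i : ℝ) * z.2 j ∂ρ =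
        ∫ z in Sᶜ, cbfKernel p z.1 * ((z.2 i : ℝ) * z.2 j) ∂ρ := by
      rw [← integral_const_mul]
      refine setIntegral_congr_fun hSm.compl fun z hz => ?_
      have hz0 : (z.1 : ℝ) = 0 := by simpa [hS] using hz
      simp [cbfKernel, hz0]
    simp only [of_apply, h1, smul_eq_mul, h2]
    rw [add_comm, integral_add_compl hSm hk]

theorem posSemidef_integral {α : Type*} [MeasurableSpace α] {μ : Measure α} {m : ℕ}
    {G : α → Matrix (Fin m) (Fin m) ℝ} (hG : ∀ᵐ a ∂μ, (G a).PosSemidef)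
    (hi : ∀ i j, Integrable (fun a => G a i j) μ) :
    (Matrix.of fun i j => ∫ a, G a i j ∂μ).PosSemidef := by
  refine PosSemidef.of_dotProduct_mulVec_nonneg ?_ fun v => ?_
  · ext i j
    simp only [conjTranspose_apply, of_apply, star_trivial]
    refine integral_congr_ae ?_
    filter_upwards [hG] with a ha
    simpa using ha.1.apply i j
  · have : star v ⬝ᵥ (Matrix.of fun i j => ∫ a, G a i j ∂μ) *ᵥ v =
        ∫ a, star v ⬝ᵥ (G a) *ᵥ v ∂μ := by
      simp only [dotProduct, mulVec, Finset.mul_sum, of_apply]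
      rw [integral_finsetSum _ fun i _ => integrable_finsetSum _ fun j _ =>
        ((hi i j).mul_const _).const_mul _]
      refine Finset.sum_congr rfl fun i _ => ?_
      rw [integral_finsetSum _ fun j _ => ((hi i j).mul_const _).const_mul _]
      refine Finset.sum_congr rfl fun j _ => ?_
      rw [integral_const_mul, integral_mul_const]
    rw [this]
    refine integral_nonneg_of_ae ?_
    filter_upwards [hG] with a ha
    exact ha.dotProduct_mulVec_nonneg v

/-- A step function approximating `r ↦ (p + r)⁻¹` from below on `[0, ∞)`. -/
noncomputable def invStep (n : ℕ) (p r : ℝ) : ℝ :=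
  if ⌊r * (n + 1)⌋₊ < (n + 1) ^ 2 then (p + ((⌊r * (n + 1)⌋₊ : ℝ) + 1) / (n + 1))⁻¹ else 0

theorem invStep_nonneg (n : ℕ) {p : ℝ} (hp : 0 < p) (r : ℝ) : 0 ≤ invStep n p r := by
  unfold invStep
  split_ifs <;> positivity

theorem invStep_le (n : ℕ) {p : ℝ} (hp : 0 < p) {r : ℝ} (hr : 0 ≤ r) :
    invStep n p r ≤ (p + r)⁻¹ := by
  unfold invStep
  split_ifs
  · gcongr
    rw [le_div_iff₀ (by positivity)]
    exact (Nat.lt_floor_add_one _).le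
  · positivity

theorem tendsto_invStep {p : ℝ} (hp : 0 < p) {r : ℝ} (hr : 0 ≤ r) :
    Tendsto (fun n => invStep n p r) atTop (𝓝 (p + r)⁻¹) := by
  have h1 : Tendsto (fun n : ℕ => (n : ℝ) + 1) atTop atTop :=
    tendsto_atTop_add_const_right _ _ tendsto_natCast_atTop_atTop
  have h2 : Tendsto (fun n : ℕ => ((⌊r * (n + 1)⌋₊ : ℝ) + 1) / (n + 1)) atTop (𝓝 r) := by
    have := ((tendsto_nat_floor_mul_div_atTop hr).comp h1).add
      (tendsto_inv_atTop_zero.comp h1)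
    simpa [add_div, Function.comp_def] using this
  refine ((h2.const_add p).inv₀ (by positivity)).congr' ?_
  filter_upwards [h1.eventually_gt_atTop r] with n hn
  have : ⌊r * (n + 1)⌋₊ < (n + 1) ^ 2 := by
    rw [Nat.floor_lt (by positivity)]
    push_cast
    nlinarith
  simp [invStep, this]

theorem invStep_eq_sum (n : ℕ) (p r : ℝ) :
    invStep n p r = ∑ k : Fin ((n + 1) ^ 2), (p + ((k : ℕ) + 1) / (n + 1))⁻¹ *
      {r : ℝ | ⌊r * (n + 1)⌋₊ = k}.indicator 1 r := by
  rw [Fin.sum_univ_eq_sum_range (fun k : ℕ => (p + ((k : ℝ) + 1) / (n + 1))⁻¹ *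
      {r : ℝ | ⌊r * (n + 1)⌋₊ = k}.indicator 1 r)]
  simp [invStep, indicator_apply]

theorem measurable_invStep (n : ℕ) (p : ℝ) : Measurable (invStep n p) := by
  unfold invStep
  have h : Measurable fun r : ℝ => ⌊r * (n + 1)⌋₊ := Nat.measurable_floor.comp (by fun_prop)
  refine Measurable.ite (h (measurableSet_Iio)) ?_ measurable_const
  have h' : Measurable fun r : ℝ => (⌊r * (n + 1)⌋₊ : ℝ) := measurable_from_top.comp h
  fun_prop

theorem IsStieltjesM.exists_rational_approx {m : ℕ} {Y : ℝ → Matrix (Fin m) (Fin m) ℝ}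
    (hY : IsStieltjesM m Y) :
    ∃ T : ℕ → ℝ → Matrix (Fin m) (Fin m) ℝ,
      (∀ n, ∃ (N : ℕ) (C : Matrix (Fin m) (Fin m) ℝ) (V : Matrix (Fin N × Fin m) (Fin m) ℝ)
        (r : Fin N × Fin m → ℝ), C.PosDef ∧ (∀ k, 0 < r k) ∧
          ∀ p, T n p = C + Vᵀ * diagonal (fun k => (p + r k)⁻¹) * V) ∧
      ∀ p, 0 < p → Tendsto (fun n => T n p) atTop (𝓝 (Y p)) := by
  obtain ⟨C, μ, G, hC, -, hfin, hGm, hG, ⟨M, hM⟩, hYp⟩ := hY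
  set μ' := μ.restrict (Ici (0 : ℝ)) with hμ'
  have hpos : ∀ᵐ r ∂μ', (0 : ℝ) ≤ r := ae_restrict_mem measurableSet_Ici
  replace hG : ∀ᵐ r ∂μ', (G r).PosSemidef := ae_restrict_of_ae hG
  replace hM : ∀ᵐ r ∂μ', ∀ i j, |G r i j| ≤ M := ae_restrict_of_ae hM
  have hint : Integrable (fun r : ℝ => (1 + r)⁻¹) μ' := by
    refine ⟨by fun_prop, ?_⟩
    rw [hasFiniteIntegral_iff_ofReal]
    · exact hfin
    · filter_upwards [hpos] with r hr
      show 0 ≤ (1 + r)⁻¹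
      positivity
  -- Any weight of order `(1 + r)⁻¹` is integrable against the entries of `G`.
  have hGi : ∀ {a : ℝ → ℝ} (K : ℝ), AEStronglyMeasurable a μ' →
      (∀ᵐ r ∂μ', |a r| ≤ K * (1 + r)⁻¹) → ∀ i j, Integrable (fun r => a r * G r i j) μ' := by
    intro a K ham ha i j
    refine Integrable.mono' ((hint.const_mul K).mul_const M)
      (ham.mul (hGm i j).aestronglyMeasurable) ?_
    filter_upwards [ha, hM] with r har hMr
    rw [norm_mul]
    exact mul_le_mul har (hMr i j) (norm_nonneg _) ((abs_nonneg _).trans har)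
  have hpi : ∀ p : ℝ, 0 < p → ∀ i j, Integrable (fun r => (p + r)⁻¹ * G r i j) μ' := by
    intro p hp
    refine hGi (max 1 p⁻¹) (by fun_prop) ?_
    filter_upwards [hpos] with r hr
    rw [abs_of_nonneg (by positivity), inv_le_iff_one_le_mul₀ (by positivity)]
    rw [mul_assoc, inv_mul_eq_div, ← mul_div_assoc, one_le_div (by positivity)]
    have h1 : p⁻¹ * p = 1 := inv_mul_cancel₀ hp.ne'
    have h2 := le_max_left 1 p⁻¹
    have h3 : p⁻¹ * p ≤ max 1 p⁻¹ * p := by gcongr; exact le_max_right _ _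
    nlinarith
  have hcell : ∀ (n k : ℕ) i j,
      IntegrableOn (fun r => G r i j) {r : ℝ | ⌊r * (n + 1)⌋₊ = k} μ' := by
    intro n k i j
    have hms : MeasurableSet {r : ℝ | ⌊r * (n + 1)⌋₊ = k} :=
      (Nat.measurable_floor.comp (by fun_prop : Measurable fun r : ℝ => r * (n + 1)))
        (measurableSet_singleton k)
    rw [← integrable_indicator_iff hms]
    refine (hGi (a := {r : ℝ | ⌊r * (n + 1)⌋₊ = k}.indicator 1) (k + 2)
      (measurable_one.indicator hms).aestronglyMeasurable ?_ i j).congr ?_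
    · filter_upwards [hpos] with r hr
      rw [indicator_apply]
      split_ifs with h
      · have h1 := Nat.lt_floor_add_one (r * (n + 1))
        rw [h.out] at h1
        have h2 : r ≤ r * (n + 1) := le_mul_of_one_le_right hr (by simp)
        rw [Pi.one_apply, abs_one, ← div_eq_mul_inv, one_le_div (by positivity)]
        linarith
      · rw [abs_zero]
        positivity
    · refine ae_of_all _ fun r => ?_
      by_cases h : ⌊r * (n + 1)⌋₊ = k <;> simp [h]
  have hS : ∀ n k : ℕ, ∃ B : Matrix (Fin m) (Fin m) ℝ,
      (Matrix.of fun i j => ∫ r in {r : ℝ | ⌊r * (n + 1)⌋₊ = k}, G r i j ∂μ') = Bᵀ * B := by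
    intro n k
    have h := posSemidef_integral (ae_restrict_of_ae (s := {r : ℝ | ⌊r * (n + 1)⌋₊ = k}) hG)
      (hcell n k)
    open scoped MatrixOrder Matrix.Norms.L2Operator in
    obtain ⟨B, hB⟩ := CStarAlgebra.nonneg_iff_eq_star_mul_self.mp h.nonneg
    exact ⟨B, by simpa [star_eq_conjTranspose] using hB⟩
  choose B hB using hS
  refine ⟨fun n p => C + ((n : ℝ) + 1)⁻¹ • (1 : Matrix (Fin m) (Fin m) ℝ) +
    Matrix.of fun i j => ∫ r, invStep n p r * G r i j ∂μ', fun n => ?_, fun p hp => ?_⟩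
  · refine ⟨(n + 1) ^ 2, C + ((n : ℝ) + 1)⁻¹ • (1 : Matrix (Fin m) (Fin m) ℝ),
      Matrix.of fun k i => B n k.1 k.2 i, fun k => ((k.1 : ℕ) + 1) / (n + 1), ?_, fun k => ?_,
      fun p => ?_⟩
    · exact PosDef.posSemidef_add hC (PosDef.one.smul (by positivity))
    · positivity
    · dsimp only
      congr 1
      ext i j
      rw [of_apply, transpose_mul_diagonal_mul_eq_sum, Matrix.sum_apply, Fintype.sum_prod_type]
      have hms : ∀ k : ℕ, MeasurableSet {r : ℝ | ⌊r * (n + 1)⌋₊ = k} := fun k =>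
        (Nat.measurable_floor.comp (by fun_prop : Measurable fun r : ℝ => r * (n + 1)))
          (measurableSet_singleton k)
      have h1 : ∀ r, invStep n p r * G r i j =
          ∑ k : Fin ((n + 1) ^ 2), (p + ((k : ℕ) + 1) / (n + 1))⁻¹ *
            {r : ℝ | ⌊r * (n + 1)⌋₊ = k}.indicator (fun r => G r i j) r := fun r => by
        rw [invStep_eq_sum, Finset.sum_mul]
        refine Finset.sum_congr rfl fun k _ => ?_
        by_cases h : ⌊r * (n + 1)⌋₊ = k <;> simp [h]
      simp_rw [h1]
      rw [integral_finsetSum _ fun (k : Fin ((n + 1) ^ 2)) _ =>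
        ((integrable_indicator_iff (hms (k : ℕ))).2 (hcell n (k : ℕ) i j)).const_mul _]
      refine Finset.sum_congr rfl fun k _ => ?_
      rw [integral_const_mul, integral_indicator (hms k)]
      have h2 := congrFun (congrFun (hB n k) i) j
      rw [of_apply, Matrix.mul_apply] at h2
      rw [h2, Finset.mul_sum]
      rfl
  · rw [hYp p hp]
    refine Tendsto.add ?_ ?_
    · have h := (tendsto_inv_atTop_zero.comp (tendsto_atTop_add_const_right _ (1 : ℝ)
        (tendsto_natCast_atTop_atTop (R := ℝ)))).smul_const (1 : Matrix (Fin m) (Fin m) ℝ)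
      simpa using h.const_add C
    · refine tendsto_pi_nhds.2 fun i => tendsto_pi_nhds.2 fun j => ?_
      refine tendsto_integral_of_dominated_convergence (fun r => ‖(p + r)⁻¹ * G r i j‖)
        (fun n => ((measurable_invStep n p).mul (hGm i j)).aestronglyMeasurable)
        (hpi p hp i j).norm (fun n => ?_) ?_
      · filter_upwards [hpos] with r hr
        rw [norm_mul, norm_mul]
        gcongr
        rw [Real.norm_of_nonneg (invStep_nonneg n hp r), Real.norm_of_nonneg (by positivity)]
        exact invStep_le n hp hr
      · filter_upwards [hpos] with r hr
        exact (tendsto_invStep hp hr).mul_const _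

theorem tendsto_matrix_inv {m : ℕ} {T : ℕ → Matrix (Fin m) (Fin m) ℝ}
    {A : Matrix (Fin m) (Fin m) ℝ} (hT : Tendsto T atTop (𝓝 A)) (hA : IsUnit A) :
    Tendsto (fun n => (T n)⁻¹) atTop (𝓝 A⁻¹) := by
  have hdet : A.det ≠ 0 := ((isUnit_iff_isUnit_det A).1 hA).ne_zero
  simp only [inv_def, Ring.inverse_eq_inv']
  have h1 : Tendsto (fun n => (T n).det) atTop (𝓝 A.det) :=
    (continuous_id.matrix_det.tendsto A).comp hT
  have h2 : Tendsto (fun n => (T n).adjugate) atTop (𝓝 A.adjugate) :=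
    (continuous_id.matrix_adjugate.tendsto A).comp hT
  exact (h1.inv₀ hdet).smul h2

/-- If `Y` is an `S₊`-valued Stieltjes function on `(0,∞)` that does not
vanish identically and `Y(p)` is invertible for every `p > 0`, then `p ↦ Y(p)⁻¹` is an
`S₊`-valued complete Bernstein function. -/
theorem inv_stieltjes_isCBF (m : ℕ) (Y : ℝ → Matrix (Fin m) (Fin m) ℝ)
    (hY : IsStieltjesM m Y)
    (hnz : ¬ ∀ p ∈ Set.Ioi (0:ℝ), Y p = 0)
    (hinv : ∀ p ∈ Set.Ioi (0:ℝ), IsUnit (Y p)) :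
    IsCBFM m (fun p => (Y p)⁻¹) := by
  obtain ⟨T, hT, hlim⟩ := hY.exists_rational_approx
  have hlim' : ∀ p, 0 < p → Tendsto (fun n => (T n p)⁻¹) atTop (𝓝 (Y p)⁻¹) := fun p hp =>
    tendsto_matrix_inv (hlim p hp) (hinv p hp)
  set c : ℝ := |(Y 1)⁻¹.trace| + 1 with hc
  have hc0 : 0 ≤ c := by positivity
  have htr : ∀ᶠ n in atTop, (T n 1)⁻¹.trace < c ^ 2 := by
    have h : Tendsto (fun n => (T n 1)⁻¹.trace) atTop (𝓝 (Y 1)⁻¹.trace) :=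
      (continuous_id.matrix_trace.tendsto _).comp (hlim' 1 one_pos)
    refine h.eventually_lt_const ?_
    have := le_abs_self (Y 1)⁻¹.trace
    nlinarith [abs_nonneg (Y 1)⁻¹.trace]
  obtain ⟨ρ, hρ⟩ := exists_probabilityMeasure_integral_cbfKernel_of_tendsto (c := c)
    (Z := fun n p => (T n p)⁻¹) (W := fun p => (Y p)⁻¹) (htr.mono fun n hn => by
      obtain ⟨N, C, V, r, hC, hr, hTn⟩ := hT n
      obtain ⟨k, s, u, h⟩ := inv_rational_stieltjes_eq_sum hC V hr
      simp_rw [← hTn] at h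
      obtain ⟨ρ, hρ⟩ := exists_probabilityMeasure_integral_eq_sum s u hc0 (by
        rw [h 1 one_pos, trace_sum] at hn
        simpa [cbfKernel, trace, vecMulVec_apply, sq] using hn.le)
      refine ⟨ρ, fun p hp i j => ?_⟩
      rw [hρ (fun s => cbfKernel p s) i j, h p hp, Matrix.sum_apply]
      simp [vecMulVec_apply])
    (fun p hp i j => ((continuous_apply_apply i j).tendsto _).comp (hlim' p hp))
  exact isCBFM_of_eq_integral_cbfKernel hc0 (ρ : Measure _) hρ
end
end
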